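/- arXiv:math/9607226 — 3 statements merged into one kernel-verified Lean document; each statement's English description precedes it below -/
import Mathlib

section
/- Assume the Irrationality Hypothesis. Then the almost sure theory T^α is nearly model complete: for every L⁺-formula φ(x₁,…,x_r) there is a Boolean combination ψ(x₁,…,x_r) of existential formulas such that T^α entails ∀x₁…∀x_r (φ(x̄) ↔ ψ(x̄)). -/
open FirstOrder Filter Topology
open scoped Classical

/-- The finite relational language with relation symbols `R i` of arity `k i`, for `i : Fin p`. -/
def Lang (p : ℕ) (k : Fin p → ℕ) : FirstOrder.Language where
  Functions := fun _ => Empty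
  Relations := fun n => { i : Fin p // k i = n }

variable {p : ℕ}

section StructureDefs

/-- The relation `R i` holds on the finite set `C` (set-version of the relation). -/
def HoldsOn (k : Fin p → ℕ) {M : Type*} [(Lang p k).Structure M]
    (i : Fin p) (C : Finset M) : Prop :=
  ∃ v : Fin (k i) → M, Function.Injective v ∧ Finset.image v Finset.univ = C ∧
    Language.Structure.RelMap (L := Lang p k) (⟨i, rfl⟩ : (Lang p k).Relations (k i)) v

/-- `w i A` : the number of `k i`-element subsets of `A` on which `R i` holds. -/
noncomputable def w (k : Fin p → ℕ) {M : Type*} [(Lang p k).Structure M]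
    (i : Fin p) (A : Finset M) : ℕ :=
  Set.ncard {C : Finset M | C ⊆ A ∧ C.card = k i ∧ HoldsOn k i C}

/-- `e(A) = Σ_i α_i · w_i(A)`. -/
noncomputable def eVal (k : Fin p → ℕ) (α : Fin p → ℝ) {M : Type*} [(Lang p k).Structure M]
    (A : Finset M) : ℝ :=
  ∑ i : Fin p, α i * (w k i A : ℝ)

/-- `δ(A) = |A| − e(A)`. -/
noncomputable def delta (k : Fin p → ℕ) (α : Fin p → ℝ) {M : Type*} [(Lang p k).Structure M]
    (A : Finset M) : ℝ :=
  (A.card : ℝ) - eVal k α A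

/-- A structure is symmetric and irreflexive: relations hold only on tuples of pairwise
distinct elements and are invariant under permutations of the tuple. -/
def SymmIrr (k : Fin p → ℕ) (M : Type*) [(Lang p k).Structure M] : Prop :=
  (∀ (n : ℕ) (r : (Lang p k).Relations n) (v : Fin n → M),
      Language.Structure.RelMap r v → Function.Injective v) ∧
  (∀ (n : ℕ) (r : (Lang p k).Relations n) (v : Fin n → M) (σ : Equiv.Perm (Fin n)),
      Language.Structure.RelMap r v → Language.Structure.RelMap r (v ∘ σ))

/-- Membership in the class `K`: a symmetric irreflexive structure all of whose finite
substructures have (hereditarily) nonnegative `δ`. -/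
def InK (k : Fin p → ℕ) (α : Fin p → ℝ) (M : Type*) [(Lang p k).Structure M] : Prop :=
  SymmIrr k M ∧ ∀ A : Finset M, 0 ≤ delta k α A

/-- A finite structure is in `K_α` if it is symmetric irreflexive and `δ(A) ≥ 0` for every
substructure. -/
def InKalpha (k : Fin p → ℕ) (α : Fin p → ℝ) (B : Type*) [(Lang p k).Structure B] : Prop :=
  SymmIrr k B ∧ ∀ S : Finset B, 0 ≤ delta k α S

/-- `d_B(X) = inf { δ(Y) : X ⊆ Y ⊆ B }` (relative version, inside the finite set `B`). -/
noncomputable def dRel (k : Fin p → ℕ) (α : Fin p → ℝ) {M : Type*} [(Lang p k).Structure M]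
    (B X : Finset M) : ℝ :=
  sInf {r : ℝ | ∃ Y : Finset M, X ⊆ Y ∧ Y ⊆ B ∧ r = delta k α Y}

/-- `A ≤_s B` for finite sets: `A ⊆ B` and `d_A(X) = d_B(X)` for all `X ⊆ A`. -/
def StrongIn (k : Fin p → ℕ) (α : Fin p → ℝ) {M : Type*} [(Lang p k).Structure M]
    (A B : Finset M) : Prop :=
  A ⊆ B ∧ ∀ X : Finset M, X ⊆ A → dRel k α A X = dRel k α B X

/-- `A ≤_i B` (intrinsic extension): there is no `A'` with `A ⊆ A' ⊊ B` and `A' ≤_s B`. -/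
def IntrinsicIn (k : Fin p → ℕ) (α : Fin p → ℝ) {M : Type*} [(Lang p k).Structure M]
    (A B : Finset M) : Prop :=
  A ⊆ B ∧ ∀ A' : Finset M, A ⊆ A' → A' ⊂ B → ¬ StrongIn k α A' B

/-- `cl^m_M(A)`: the union of all `B ⊆ M` with `A ≤_i B` and `|B − A| < m`. -/
def cl (k : Fin p → ℕ) (α : Fin p → ℝ) {M : Type*} [(Lang p k).Structure M]
    (m : ℕ) (A : Finset M) : Set M :=
  {x : M | ∃ B : Finset M, IntrinsicIn k α A B ∧ (B \ A).card < m ∧ x ∈ B}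

/-- `C` and `B'` are freely joined over `A` (inside the ambient structure): they intersect in
`A` and every relation on a subset of `C ∪ B'` lives entirely inside `C` or inside `B'`. -/
def FreelyJoined (k : Fin p → ℕ) {M : Type*} [(Lang p k).Structure M]
    (A C B' : Set M) : Prop :=
  C ∩ B' = A ∧
    ∀ (i : Fin p) (S : Finset M), ↑S ⊆ C ∪ B' → HoldsOn k i S → (↑S ⊆ C ∨ ↑S ⊆ B')

/-- `g` is an embedding (of relational structures). -/
def IsEmb (k : Fin p → ℕ) {M N : Type*} [(Lang p k).Structure M] [(Lang p k).Structure N]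
    (g : M → N) : Prop :=
  Function.Injective g ∧
    ∀ (n : ℕ) (r : (Lang p k).Relations n) (v : Fin n → M),
      (Language.Structure.RelMap r (g ∘ v) ↔ Language.Structure.RelMap r v)

/-- `g` restricted to `A` is an embedding of the substructure on `A`. -/
def IsEmbOn (k : Fin p → ℕ) {M N : Type*} [(Lang p k).Structure M] [(Lang p k).Structure N]
    (A : Finset M) (g : M → N) : Prop :=
  Set.InjOn g ↑A ∧
    ∀ (n : ℕ) (r : (Lang p k).Relations n) (v : Fin n → M), (∀ j, v j ∈ A) →
      (Language.Structure.RelMap r (g ∘ v) ↔ Language.Structure.RelMap r v)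

/-- `h` restricts to an isomorphism from the induced structure on `S` onto `S'`. -/
def IsIsoOn (k : Fin p → ℕ) {M N : Type*} [(Lang p k).Structure M] [(Lang p k).Structure N]
    (S : Set M) (S' : Set N) (h : M → N) : Prop :=
  Set.InjOn h S ∧ h '' S = S' ∧
    ∀ (n : ℕ) (r : (Lang p k).Relations n) (v : Fin n → M), (∀ j, v j ∈ S) →
      (Language.Structure.RelMap r (h ∘ v) ↔ Language.Structure.RelMap r v)

/-- A countable structure `M ∈ K` is `(K_α, ≤_s)`-semigeneric if for every `A ≤_s B` with
`B ∈ K_α` finite and every embedding `g` of `A` into `M`, and each `m`, there is an embedding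
`ĝ` of `B` into `M` extending `g` whose image adds nothing to the `m`-closure of `gA` and is
freely joined with `cl^m(gA)` over `gA`. -/
def Semigeneric (k : Fin p → ℕ) (α : Fin p → ℝ) (M : Type*) [(Lang p k).Structure M] : Prop :=
  Countable M ∧ InK k α M ∧
    ∀ (B : Type) (_ : Fintype B) (_ : (Lang p k).Structure B), InKalpha k α B →
      ∀ A : Finset B, StrongIn k α A Finset.univ →
        ∀ g : B → M, IsEmbOn k A g → ∀ m : ℕ,
          ∃ g' : B → M, IsEmb k g' ∧ (∀ a ∈ A, g' a = g a) ∧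
            cl k α m (Finset.image g' Finset.univ) =
              ↑(Finset.image g' Finset.univ) ∪ cl k α m (Finset.image g A) ∧
            FreelyJoined k (↑(Finset.image g A) : Set M) (cl k α m (Finset.image g A))
              (↑(Finset.image g' Finset.univ))

end StructureDefs

section FormulaDefs

/-- A formula is existential if it is an existential quantifier prefix applied to a
quantifier-free formula. -/
def IsExistential (k : Fin p → ℕ) {r : ℕ} (φ : (Lang p k).Formula (Fin r)) : Prop :=
  ∃ (m : ℕ) (ψ : (Lang p k).BoundedFormula (Fin r) m), ψ.IsQF ∧ φ = ψ.exs

/-- Boolean combinations of existential formulas. -/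
inductive IsBoolCombExistential (k : Fin p → ℕ) {r : ℕ} :
    (Lang p k).Formula (Fin r) → Prop
  | of_existential (φ) : IsExistential k φ → IsBoolCombExistential k φ
  | not (φ) : IsBoolCombExistential k φ → IsBoolCombExistential k φ.not
  | inf (φ ψ) : IsBoolCombExistential k φ → IsBoolCombExistential k ψ →
      IsBoolCombExistential k (φ ⊓ ψ)

end FormulaDefs

section Probability

/-- A configuration of potential relations on `{1,…,n}`: for each relation symbol, a Boolean
choice on each finite subset. -/
abbrev Config (p n : ℕ) := (i : Fin p) → Finset (Fin n) → Bool

/-- The valid configurations: `R i` may only hold on sets of size `k i`. -/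
noncomputable def validE (k : Fin p → ℕ) (n : ℕ) : Finset (Config p n) :=
  Finset.univ.filter (fun E => ∀ (i : Fin p) (C : Finset (Fin n)), E i C = true → C.card = k i)

/-- The probability of the configuration `E`: independently for each `i` and each
`k i`-element set `C`, the relation `R i` holds on `C` with probability `γ i · n^{-α i}`. -/
noncomputable def weight (k : Fin p → ℕ) (α γ : Fin p → ℝ) (n : ℕ) (E : Config p n) : ℝ :=
  ∏ i : Fin p, ∏ C ∈ Finset.univ.filter (fun C : Finset (Fin n) => C.card = k i),
    (if E i C = true then γ i * (n : ℝ) ^ (-(α i)) else 1 - γ i * (n : ℝ) ^ (-(α i)))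

/-- The probability `P_n` of an event (a set of configurations). -/
noncomputable def Pev (k : Fin p → ℕ) (α γ : Fin p → ℝ) (n : ℕ)
    (Q : Config p n → Prop) : ℝ :=
  ∑ E ∈ validE k n, if Q E then weight k α γ n E else 0

/-- The random `L⁺`-structure `G_n` on `Fin n` determined by the configuration `E`. -/
def structOf (k : Fin p → ℕ) (n : ℕ) (E : Config p n) : (Lang p k).Structure (Fin n) where
  funMap := fun {_} f _ => f.elim
  RelMap := fun {_} r v => Function.Injective v ∧ E r.1 (Finset.image v Finset.univ) = true

/-- The probability that `G_n ⊨ φ`. -/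
noncomputable def Pn (k : Fin p → ℕ) (α γ : Fin p → ℝ) (n : ℕ)
    (φ : (Lang p k).Sentence) : ℝ :=
  Pev k α γ n (fun E => letI := structOf k n E; (Fin n) ⊨ φ)

/-- The Irrationality Hypothesis: `α_0, …, α_{p−1}, 1` are linearly independent over `ℚ`. -/
def IrrHyp (α : Fin p → ℝ) : Prop :=
  LinearIndependent ℚ (Fin.snoc α (1 : ℝ) : Fin (p + 1) → ℝ)

/-- The almost sure theory `T^α`: the sentences with limit probability 1. -/
noncomputable def Talpha (k : Fin p → ℕ) (α γ : Fin p → ℝ) : (Lang p k).Theory :=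
  {φ : (Lang p k).Sentence | Tendsto (fun n => Pn k α γ n φ) atTop (𝓝 1)}

/-- Auxiliary: `M`, equipped with the structure `S`, satisfies the sentence `φ`. -/
def RealizeS (k : Fin p → ℕ) (M : Type*) (S : (Lang p k).Structure M)
    (φ : (Lang p k).Sentence) : Prop :=
  letI := S; M ⊨ φ

/-- Auxiliary: `M`, equipped with the structure `S`, is a model of the theory `T`. -/
def ModelsT (k : Fin p → ℕ) (M : Type*) (S : (Lang p k).Structure M)
    (T : (Lang p k).Theory) : Prop :=
  ∀ φ ∈ T, RealizeS k M S φ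

end Probability

section Predimension

variable {V W : Type*}

/-- The edges of colour `i` of the hypergraph `H` lying inside `A`. -/
noncomputable def edgesIn (H : Fin p → Finset V → Prop) (i : Fin p) (A : Finset V) :
    Finset (Finset V) :=
  A.powerset.filter (H i)

/-- The predimension `|A| − Σ_i α_i · e_i(A)` of a finite set of vertices of a hypergraph. -/
noncomputable def predim (α : Fin p → ℝ) (H : Fin p → Finset V → Prop) (A : Finset V) : ℝ :=
  (A.card : ℝ) - ∑ i, α i * ((edgesIn H i A).card : ℝ)

/-- `A` is strong with respect to all extensions by at most `m` points. -/
def StrongUpTo (α : Fin p → ℝ) (H : Fin p → Finset V → Prop) (m : ℕ) (A : Finset V) : Prop :=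
  ∀ X : Finset V, A ⊆ X → (X \ A).card ≤ m → predim α H A ≤ predim α H X

variable {α : Fin p → ℝ} {H : Fin p → Finset V → Prop} {H' : Fin p → Finset W → Prop}

lemma edgesIn_mono (i : Fin p) {A B : Finset V} (h : A ⊆ B) : edgesIn H i A ⊆ edgesIn H i B :=
  Finset.filter_subset_filter _ (Finset.powerset_mono.2 h)

lemma card_edgesIn_add_le (i : Fin p) (A B : Finset V) :
    (edgesIn H i A).card + (edgesIn H i B).card ≤
      (edgesIn H i (A ∪ B)).card + (edgesIn H i (A ∩ B)).card := by
  have h1 : edgesIn H i A ∩ edgesIn H i B = edgesIn H i (A ∩ B) := by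
    ext C; simp only [edgesIn, Finset.mem_inter, Finset.mem_filter, Finset.mem_powerset,
      Finset.subset_inter_iff]; tauto
  rw [← Finset.card_union_add_card_inter, h1]
  have := Finset.card_le_card (Finset.union_subset
    (edgesIn_mono (H := H) i (Finset.subset_union_left (s₁ := A) (s₂ := B)))
    (edgesIn_mono (H := H) i (Finset.subset_union_right (s₁ := A) (s₂ := B))))
  omega

lemma predim_union_add_inter_le (hα : ∀ i, 0 ≤ α i) (A B : Finset V) :
    predim α H (A ∪ B) + predim α H (A ∩ B) ≤ predim α H A + predim α H B := by
  have h1 : ((A ∪ B).card : ℝ) + (A ∩ B).card = A.card + B.card := by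
    exact_mod_cast Finset.card_union_add_card_inter A B
  have h2 : ∑ i, α i * ((edgesIn H i A).card : ℝ) + ∑ i, α i * ((edgesIn H i B).card : ℝ) ≤
      ∑ i, α i * ((edgesIn H i (A ∪ B)).card : ℝ) +
        ∑ i, α i * ((edgesIn H i (A ∩ B)).card : ℝ) := by
    rw [← Finset.sum_add_distrib, ← Finset.sum_add_distrib]
    refine Finset.sum_le_sum fun i _ => ?_
    rw [← mul_add, ← mul_add]
    exact mul_le_mul_of_nonneg_left (by exact_mod_cast card_edgesIn_add_le i A B) (hα i)
  unfold predim
  linarith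

lemma predim_le_card (hα : ∀ i, 0 ≤ α i) (A : Finset V) : predim α H A ≤ A.card := by
  have : 0 ≤ ∑ i, α i * ((edgesIn H i A).card : ℝ) :=
    Finset.sum_nonneg fun i _ => mul_nonneg (hα i) (Nat.cast_nonneg _)
  unfold predim
  linarith

lemma predim_sub_eq {A X : Finset V} (h : A ⊆ X) :
    predim α H X - predim α H A =
      (X \ A).card - ∑ i, α i * ((edgesIn H i X \ edgesIn H i A).card : ℝ) := by
  have h1 : ((X \ A).card : ℝ) = X.card - A.card := by
    rw [Finset.card_sdiff_of_subset h, Nat.cast_sub (Finset.card_le_card h)]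
  have h2 : ∀ i, ((edgesIn H i X \ edgesIn H i A).card : ℝ) =
      (edgesIn H i X).card - (edgesIn H i A).card := fun i => by
    rw [Finset.card_sdiff_of_subset (edgesIn_mono i h),
      Nat.cast_sub (Finset.card_le_card (edgesIn_mono i h))]
  simp only [h1, h2, mul_sub, Finset.sum_sub_distrib, predim]
  ring

lemma predim_image {f : V → W} {A : Finset V} (hf : Set.InjOn f A)
    (hH : ∀ i, ∀ C ⊆ A, (H' i (C.image f) ↔ H i C)) :
    predim α H' (A.image f) = predim α H A := by
  have h : ∀ i, (edgesIn H' i (A.image f)).card = (edgesIn H i A).card := fun i => by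
    symm
    refine Finset.card_bij (fun C _ => C.image f) ?_ ?_ ?_
    · intro C hC
      simp only [edgesIn, Finset.mem_filter, Finset.mem_powerset] at hC ⊢
      exact ⟨Finset.image_subset_image hC.1, (hH i C hC.1).2 hC.2⟩
    · intro C hC D hD hCD
      simp only [edgesIn, Finset.mem_filter, Finset.mem_powerset] at hC hD
      have key : ∀ C D : Finset V, C ⊆ A → D ⊆ A → C.image f = D.image f → C ⊆ D := by
        intro C D hC hD hCD x hx
        obtain ⟨y, hy, hyx⟩ := Finset.mem_image.1 (hCD ▸ Finset.mem_image_of_mem f hx)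
        exact hf (hD hy) (hC hx) hyx ▸ hy
      exact (key C D hC.1 hD.1 hCD).antisymm (key D C hD.1 hC.1 hCD.symm)
    · intro D hD
      simp only [edgesIn, Finset.mem_filter, Finset.mem_powerset] at hD
      obtain ⟨C, hCA, rfl⟩ := Finset.subset_image_iff.1 hD.1
      exact ⟨C, by simp only [edgesIn, Finset.mem_filter, Finset.mem_powerset]
                   exact ⟨by exact_mod_cast hCA, (hH i C (by exact_mod_cast hCA)).1 hD.2⟩, rfl⟩
  simp only [predim, h, Finset.card_image_of_injOn hf]

lemma StrongUpTo.mono {m m' : ℕ} (h : m ≤ m') {A : Finset V} (hA : StrongUpTo α H m' A) :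
    StrongUpTo α H m A :=
  fun X hX hc => hA X hX (hc.trans h)

/-- Strength up to `m` is transitive. -/
lemma StrongUpTo.of_subset (hα : ∀ i, 0 ≤ α i) {m : ℕ} {B C : Finset V}
    (hB : StrongUpTo α H m B) (hCB : C ⊆ B)
    (hC : ∀ X, C ⊆ X → X ⊆ B → (X \ C).card ≤ m → predim α H C ≤ predim α H X) :
    StrongUpTo α H m C := by
  intro X hX hXm
  have h1 := predim_union_add_inter_le (H := H) hα X B
  have h2 := hB (X ∪ B) Finset.subset_union_right ((Finset.card_le_card (by
    intro a; simp only [Finset.mem_sdiff, Finset.mem_union]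
    rintro ⟨h | h, h'⟩
    · exact ⟨h, fun h'' => h' (hCB h'')⟩
    · exact absurd h h')).trans hXm)
  have h3 := hC (X ∩ B) (Finset.subset_inter hX hCB) Finset.inter_subset_right
    ((Finset.card_le_card (Finset.sdiff_subset_sdiff Finset.inter_subset_left le_rfl)).trans hXm)
  linarith

/-- Below `D`, the possible values of relative predimensions of bounded sets stay away
from `D`. -/
lemma exists_gap (hα : ∀ i, 0 < α i) (N : ℕ) (D : ℝ) :
    ∃ ε > 0, ∀ v : ℕ, v ≤ N → ∀ e : Fin p → ℕ,
      (v : ℝ) - ∑ i, α i * (e i : ℝ) < D → (v : ℝ) - ∑ i, α i * (e i : ℝ) ≤ D - ε := by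
  set val : ℕ × (Fin p → ℕ) → ℝ := fun x => (x.1 : ℝ) - ∑ i, α i * (x.2 i : ℝ) with hval
  let S : Set (ℕ × (Fin p → ℕ)) := {x | x.1 ≤ N ∧ val x < D ∧ D - 1 < val x}
  have hS : S.Finite := by
    refine Set.Finite.subset ((Set.finite_Iic N).prod
      (Set.finite_Iic (fun i => ⌈((N : ℝ) - D + 1) / α i⌉₊))) ?_
    rintro ⟨v, e⟩ ⟨h1, -, h3⟩
    refine ⟨h1, fun i => ?_⟩
    have h4 : α i * (e i : ℝ) ≤ ∑ i, α i * (e i : ℝ) :=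
      Finset.single_le_sum (f := fun i => α i * (e i : ℝ))
        (fun j _ => mul_nonneg (hα j).le (Nat.cast_nonneg _)) (Finset.mem_univ i)
    have h5 : (v : ℝ) ≤ N := by exact_mod_cast h1
    simp only [hval] at h3
    have h6 : (e i : ℝ) ≤ ((N : ℝ) - D + 1) / α i := by
      rw [le_div_iff₀ (hα i)]; linarith
    exact_mod_cast h6.trans (Nat.le_ceil _)
  have hT : ∃ ε > 0, ∀ x ∈ hS.toFinset, ε ≤ D - val x := by
    by_cases hne : hS.toFinset.Nonempty
    · obtain ⟨x, hx, hmin⟩ := hS.toFinset.exists_min_image (fun x => D - val x) hne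
      exact ⟨D - val x, by have := (hS.mem_toFinset.1 hx).2.1; linarith, hmin⟩
    · rw [Finset.not_nonempty_iff_eq_empty] at hne
      exact ⟨1, one_pos, by simp [hne]⟩
  obtain ⟨ε, hε, hmin⟩ := hT
  refine ⟨min ε 1, by positivity, fun v hv e hlt => ?_⟩
  by_cases h : D - 1 < val (v, e)
  · have := hmin (v, e) (hS.mem_toFinset.2 ⟨hv, hlt, h⟩)
    have h1 := min_le_left ε 1
    simp only [hval] at this
    linarith
  · have h1 := min_le_right ε 1
    simp only [hval] at h
    linarith

lemma exists_predim_gap (hα : ∀ i, 0 < α i) (N : ℕ) (D : ℝ) :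
    ∃ ε > 0, ∀ (V : Type) (H : Fin p → Finset V → Prop) (A X : Finset V), A ⊆ X →
      (X \ A).card ≤ N → predim α H X - predim α H A < D →
        predim α H X - predim α H A ≤ D - ε := by
  obtain ⟨ε, hε, h⟩ := exists_gap hα N D
  refine ⟨ε, hε, fun V H A X hAX hN => ?_⟩
  rw [predim_sub_eq hAX]
  exact h _ hN _

/-- Every finite set is contained in a strong set of bounded size. -/
lemma exists_strongUpTo_superset (hα : ∀ i, 0 < α i) (m a : ℕ) :
    ∃ f : ℕ, ∀ (V : Type) (H : Fin p → Finset V → Prop), (∀ A, 0 ≤ predim α H A) →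
      ∀ A : Finset V, A.card ≤ a → ∃ C, A ⊆ C ∧ C.card ≤ f ∧ StrongUpTo α H m C := by
  obtain ⟨ε, hε, hgap⟩ := exists_predim_gap hα m 0
  obtain ⟨J, hJ⟩ := exists_nat_gt ((a : ℝ) / ε)
  rw [div_lt_iff₀ hε] at hJ
  refine ⟨a + J * m, fun V H hH => ?_⟩
  have key : ∀ J : ℕ, ∀ A : Finset V, predim α H A < J * ε →
      ∃ C, A ⊆ C ∧ C.card ≤ A.card + J * m ∧ StrongUpTo α H m C := by
    intro J
    induction J with
    | zero => intro A hA; have := hH A; simp at hA; linarith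
    | succ J ih =>
      intro A hA
      by_cases hs : StrongUpTo α H m A
      · exact ⟨A, le_rfl, by simp, hs⟩
      · simp only [StrongUpTo, not_forall, not_le] at hs
        obtain ⟨X, hAX, hXm, hlt⟩ := hs
        have := hgap V H A X hAX hXm (by linarith)
        push_cast at hA
        obtain ⟨C, hXC, hC, hCs⟩ := ih X (by linarith)
        refine ⟨C, hAX.trans hXC, hC.trans ?_, hCs⟩
        rw [Finset.card_sdiff_of_subset hAX] at hXm
        have := Finset.card_le_card hAX
        rw [add_mul, one_mul]
        omega
  intro A hA
  obtain ⟨C, h1, h2, h3⟩ := key J A (by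
    have := predim_le_card (H := H) (fun i => (hα i).le) A
    have h' : (A.card : ℝ) ≤ a := by exact_mod_cast hA
    linarith)
  exact ⟨C, h1, by omega, h3⟩

lemma IrrHyp.sub_sum_ne_zero (hirr : IrrHyp α) {v : ℕ} (hv : v ≠ 0) (e : Fin p → ℕ) :
    (v : ℝ) - ∑ i, α i * (e i : ℝ) ≠ 0 := by
  intro h
  have := Fintype.linearIndependent_iff.1 hirr (Fin.snoc (fun i => -(e i : ℚ)) (v : ℚ)) (by
    rw [Fin.sum_univ_castSucc]
    simp only [Fin.snoc_castSucc, Fin.snoc_last, Rat.smul_def]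
    push_cast
    simp only [neg_mul, Finset.sum_neg_distrib, mul_one]
    simp only [mul_comm (α _)] at h
    linarith) (Fin.last p)
  simp at this
  exact hv this

end Predimension

section BackAndForth

variable (k : Fin p → ℕ) (α : Fin p → ℝ)

/-- The hypergraph underlying a structure. -/
def hyp (M : Type*) [(Lang p k).Structure M] : Fin p → Finset M → Prop :=
  fun i C => HoldsOn k i C

/-- Structures whose finite subsets have nonnegative predimension, and in which strong extensions
of sufficiently strong sets are realized by strong sets. -/
structure AlphaModel (M : Type) [(Lang p k).Structure M] : Prop where
  symmIrr : SymmIrr k M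
  nonneg : ∀ A, 0 ≤ predim α (hyp k M) A
  exists_extension : ∀ (a b m : ℕ) (H : Fin p → Finset (Fin a ⊕ Fin b) → Prop),
    (∀ i C, H i C → C.card = k i) →
    (∀ X : Finset (Fin b), predim α H (Finset.univ.disjSum ∅) ≤
      predim α H (Finset.univ.disjSum X)) →
    ∀ x : Fin a → M, Function.Injective x →
      (∀ i (C : Finset (Fin a)), HoldsOn k i (C.image x) ↔ H i (C.image Sum.inl)) →
      StrongUpTo α (hyp k M) (b + m) (Finset.univ.image x) →
      ∃ y : Fin b → M, Function.Injective (Sum.elim x y) ∧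
        (∀ i C, HoldsOn k i (C.image (Sum.elim x y)) ↔ H i C) ∧
        StrongUpTo α (hyp k M) m (Finset.univ.image (Sum.elim x y))

variable {k α} {M N : Type} [(Lang p k).Structure M] [(Lang p k).Structure N]

lemma HoldsOn.card_eq {i : Fin p} {C : Finset M} (h : HoldsOn k i C) : C.card = k i := by
  obtain ⟨v, hv, rfl, -⟩ := h
  simp [Finset.card_image_of_injective _ hv]

lemma SymmIrr.relMap_iff (hM : SymmIrr k M) {n : ℕ} (r : (Lang p k).Relations n)
    (v : Fin n → M) : Language.Structure.RelMap r v ↔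
      Function.Injective v ∧ HoldsOn k r.1 (Finset.univ.image v) := by
  obtain ⟨i, rfl⟩ := r
  constructor
  · exact fun h => ⟨hM.1 _ _ _ h, v, hM.1 _ _ _ h, rfl, h⟩
  · rintro ⟨hv, v', hv', himg, h⟩
    have h1 : ∀ j, ∃ l, v' l = v j := fun j => by
      have : v j ∈ Finset.univ.image v' := himg ▸ Finset.mem_image_of_mem v (Finset.mem_univ j)
      simpa using this
    choose σ hσ using h1
    have hinj : Function.Injective σ := fun a b hab => hv (by rw [← hσ, ← hσ, hab])
    have := hM.2 _ _ v' (Equiv.ofBijective σ (Finite.injective_iff_bijective.1 hinj)) h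
    convert this using 1
    funext j
    exact (hσ j).symm

/-- Two tuples carry the same hyperedges. -/
def SameHyp (k : Fin p → ℕ) {M N : Type} [(Lang p k).Structure M] [(Lang p k).Structure N]
    {ι : Type} (u : ι → M) (u' : ι → N) : Prop :=
  ∀ i (C : Finset ι), HoldsOn k i (C.image u) ↔ HoldsOn k i (C.image u')

lemma SameHyp.comp {ι κ : Type} {u : ι → M} {u' : ι → N} (h : SameHyp k u u') (e : κ → ι) :
    SameHyp k (u ∘ e) (u' ∘ e) := fun i C => by
  simpa only [Finset.image_image] using h i (C.image e)

lemma predim_pullback {ι : Type} {u : ι → M} (hu : Function.Injective u) (C : Finset ι) :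
    predim α (hyp k M) (C.image u) = predim α (fun i D => HoldsOn k i (D.image u)) C :=
  predim_image hu.injOn fun _ _ _ => Iff.rfl

lemma SameHyp.predim_eq {ι : Type} {u : ι → M} {u' : ι → N} (h : SameHyp k u u')
    (hu : Function.Injective u) (hu' : Function.Injective u') (C : Finset ι) :
    predim α (hyp k M) (C.image u) = predim α (hyp k N) (C.image u') := by
  rw [predim_pullback hu, predim_pullback hu']
  congr 1
  funext i D
  exact propext (h i D)

/-- The tuples `v` and `v'` lie in corresponding positions in isomorphic `m`-strong sets. -/
def LocIso (k : Fin p → ℕ) (α : Fin p → ℝ) {M N : Type} [(Lang p k).Structure M]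
    [(Lang p k).Structure N] {κ : Type} (m : ℕ) (v : κ → M) (v' : κ → N) : Prop :=
  ∃ (s : ℕ) (u : Fin s → M) (u' : Fin s → N), Function.Injective u ∧ Function.Injective u' ∧
    SameHyp k u u' ∧ StrongUpTo α (hyp k M) m (Finset.univ.image u) ∧
    StrongUpTo α (hyp k N) m (Finset.univ.image u') ∧
    ∃ g : κ → Fin s, v = u ∘ g ∧ v' = u' ∘ g

lemma LocIso.symm {κ : Type} {m : ℕ} {v : κ → M} {v' : κ → N} (h : LocIso k α m v v') :
    LocIso k α m v' v := by
  obtain ⟨s, u, u', h1, h2, h3, h4, h5, g, h6, h7⟩ := h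
  exact ⟨s, u', u, h2, h1, fun i C => (h3 i C).symm, h5, h4, g, h7, h6⟩

lemma LocIso.mono {κ : Type} {m m' : ℕ} (hm : m ≤ m') {v : κ → M} {v' : κ → N}
    (h : LocIso k α m' v v') : LocIso k α m v v' := by
  obtain ⟨s, u, u', h1, h2, h3, h4, h5, g, h6, h7⟩ := h
  exact ⟨s, u, u', h1, h2, h3, h4.mono hm, h5.mono hm, g, h6, h7⟩

lemma SameHyp.strongUpTo_image (hα : ∀ i, 0 ≤ α i) {ι : Type} [Fintype ι] {w : ι → M} {w' : ι → N}
    (h : SameHyp k w w') (hw : Function.Injective w) (hw' : Function.Injective w') {m : ℕ}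
    (hB : StrongUpTo α (hyp k N) m (Finset.univ.image w')) {J : Finset ι}
    (hJ : StrongUpTo α (hyp k M) m (J.image w)) :
    StrongUpTo α (hyp k N) m (J.image w') := by
  refine hB.of_subset hα (Finset.image_subset_image (Finset.subset_univ J)) ?_
  intro X hX hXB hc
  obtain ⟨X₀, -, rfl⟩ := Finset.subset_image_iff.1 hXB
  rw [← h.predim_eq hw hw', ← h.predim_eq hw hw']
  refine hJ _ (Finset.image_subset_image ((Finset.image_subset_image_iff hw').1 hX)) ?_
  rw [← Finset.image_sdiff _ _ hw, Finset.card_image_of_injective _ hw]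
  rwa [← Finset.image_sdiff _ _ hw', Finset.card_image_of_injective _ hw'] at hc

lemma exists_enum {ι : Type} [DecidableEq ι] (J : Finset ι) :
    ∃ e : Fin J.card → ι, Function.Injective e ∧ Finset.univ.image e = J := by
  refine ⟨fun j => J.equivFin.symm j, fun a b h => ?_, ?_⟩
  · exact J.equivFin.symm.injective (Subtype.ext h)
  · ext x
    simp only [Finset.mem_image, Finset.mem_univ, true_and]
    constructor
    · rintro ⟨j, rfl⟩; exact (J.equivFin.symm j).2
    · intro hx; exact ⟨J.equivFin ⟨x, hx⟩, by simp⟩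

/-- The forth step of the back-and-forth argument. -/
lemma exists_locIso_forth (hα : ∀ i, 0 < α i) (m' c : ℕ) :
    ∃ m, ∀ (M N : Type) [(Lang p k).Structure M] [(Lang p k).Structure N],
      AlphaModel k α M → AlphaModel k α N → ∀ (κ : Type) [Fintype κ], Fintype.card κ ≤ c →
      ∀ (v : κ → M) (v' : κ → N), LocIso k α m v v' → ∀ x : M, ∃ x' : N,
        LocIso k α m' (Sum.elim v (fun _ : Unit => x)) (Sum.elim v' (fun _ : Unit => x')) := by
  obtain ⟨f, hf⟩ := exists_strongUpTo_superset hα m' (c + 1)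
  refine ⟨f + m', fun M N _ _ hM hN κ _ hκ v v' hvv' x => ?_⟩
  obtain ⟨s, u, u', hu, hu', huu', hus, hus', g, rfl, rfl⟩ := hvv'
  obtain ⟨C, hAC, hCf, hCs⟩ := hf M (hyp k M) hM.nonneg (insert x (Finset.univ.image (u ∘ g)))
    ((Finset.card_insert_le _ _).trans (Nat.succ_le_succ (Finset.card_image_le.trans (by
      rwa [Finset.card_univ]))))
  set Y := C \ Finset.univ.image u with hY
  have hYf : Y.card ≤ f := (Finset.card_le_card Finset.sdiff_subset).trans hCf
  obtain ⟨y, hy, hyY⟩ := exists_enum Y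
  have hyu : ∀ a j, u a ≠ y j := fun a j h => by
    have : y j ∈ Y := hyY ▸ Finset.mem_image_of_mem y (Finset.mem_univ j)
    rw [hY, Finset.mem_sdiff] at this
    exact this.2 (h ▸ Finset.mem_image_of_mem u (Finset.mem_univ a))
  have hw : Function.Injective (Sum.elim u y) := hu.sumElim hy hyu
  set w := Sum.elim u y with hwdef
  have hinl : ∀ D : Finset (Fin s), (D.image Sum.inl).image w = D.image u := fun D => by
    rw [Finset.image_image]; rfl
  have hdisj : ∀ X : Finset (Fin Y.card), ((Finset.univ : Finset (Fin s)).disjSum X).image w =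
      Finset.univ.image u ∪ X.image y := fun X => by
    ext z
    simp [Finset.mem_disjSum, hwdef]
  obtain ⟨y', hw', hH, hBs⟩ := hN.exists_extension s Y.card m'
    (fun i D => HoldsOn k i (D.image w))
    (fun i D h => by rw [← h.card_eq, Finset.card_image_of_injective _ hw])
    (fun X => by
      rw [← predim_pullback hw, ← predim_pullback hw, hdisj, hdisj]
      simp only [Finset.image_empty, Finset.union_empty]
      refine hus _ Finset.subset_union_left ?_
      rw [Finset.union_sdiff_left]
      refine (Finset.card_le_card Finset.sdiff_subset).trans (Finset.card_image_le.trans ?_)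
      have := Finset.card_le_univ X
      simp only [Fintype.card_fin] at this
      omega)
    u' hu' (fun i D => by rw [hinl]; exact (huu' i D).symm) (hus'.mono (by omega))
  set w' := Sum.elim u' y' with hwdef'
  have hww' : SameHyp k w w' := fun i D => (hH i D).symm
  set J : Finset (Fin s ⊕ Fin Y.card) := Finset.univ.filter (fun z => w z ∈ C) with hJ
  have hJC : J.image w = C := by
    ext z
    simp only [hJ, Finset.mem_image, Finset.mem_filter, Finset.mem_univ, true_and]
    constructor
    · rintro ⟨a, h1, rfl⟩; exact h1
    · intro hz
      by_cases hzu : z ∈ Finset.univ.image u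
      · obtain ⟨a, -, rfl⟩ := Finset.mem_image.1 hzu
        exact ⟨Sum.inl a, hz, rfl⟩
      · have : z ∈ Y := Finset.mem_sdiff.2 ⟨hz, hzu⟩
        rw [← hyY] at this
        obtain ⟨a, -, rfl⟩ := Finset.mem_image.1 this
        exact ⟨Sum.inr a, hz, rfl⟩
  obtain ⟨e, he, heJ⟩ := exists_enum J
  have hpos : ∀ z : Fin s ⊕ Fin Y.card, w z ∈ C → ∃ j, e j = z := fun z hz => by
    have : z ∈ Finset.univ.image e := by rw [heJ]; simp [hJ, hz]
    simpa using this
  have hg : ∀ a, ∃ j, e j = Sum.inl (g a) := fun a =>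
    hpos _ (hAC (Finset.mem_insert_of_mem (Finset.mem_image_of_mem (u ∘ g) (Finset.mem_univ a))))
  choose g₂ hg₂ using hg
  obtain ⟨z, hzJ, hzx⟩ := Finset.mem_image.1 (hJC.symm ▸ hAC (Finset.mem_insert_self x _))
  obtain ⟨j, hj⟩ := hpos z (by rw [hzx]; exact hAC (Finset.mem_insert_self x _))
  refine ⟨w' z, J.card, w ∘ e, w' ∘ e, hw.comp he, hw'.comp he, hww'.comp e, ?_, ?_,
    Sum.elim g₂ (fun _ => j), ?_, ?_⟩
  · rw [← Finset.image_image, heJ, hJC]; exact hCs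
  · rw [← Finset.image_image, heJ]
    exact hww'.strongUpTo_image (fun i => (hα i).le) hw hw' hBs (hJC.symm ▸ hCs)
  · funext a
    rcases a with a | a
    · simp [hg₂, hwdef]
    · simp [hj, hzx]
  · funext a
    rcases a with a | a
    · simp [hg₂, hwdef']
    · simp [hj]

lemma Lang.term_eq_var {κ : Type} (t : (Lang p k).Term κ) : ∃ x, t = Language.Term.var x := by
  cases t with
  | var x => exact ⟨x, rfl⟩
  | func f _ => exact f.elim

/-- Formulas are invariant under sufficiently strong local isomorphisms. -/
lemma exists_locIso_realize_iff (hα : ∀ i, 0 < α i) {r n : ℕ}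
    (φ : (Lang p k).BoundedFormula (Fin r) n) :
    ∃ m, ∀ (M N : Type) [(Lang p k).Structure M] [(Lang p k).Structure N],
      AlphaModel k α M → AlphaModel k α N →
      ∀ (v : Fin r → M) (xs : Fin n → M) (v' : Fin r → N) (xs' : Fin n → N),
        LocIso k α m (Sum.elim v xs) (Sum.elim v' xs') →
          (φ.Realize v xs ↔ φ.Realize v' xs') := by
  induction φ with
  | falsum => exact ⟨0, fun _ _ _ _ _ _ _ _ _ _ _ => Iff.rfl⟩
  | equal t₁ t₂ =>
    refine ⟨0, fun M N _ _ _ _ v xs v' xs' h => ?_⟩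
    obtain ⟨x₁, rfl⟩ := Lang.term_eq_var t₁
    obtain ⟨x₂, rfl⟩ := Lang.term_eq_var t₂
    obtain ⟨s, u, u', hu, hu', -, -, -, g, h6, h7⟩ := h
    simp only [Language.BoundedFormula.Realize, Language.Term.realize_var, h6, h7]
    simp [hu.eq_iff, hu'.eq_iff]
  | rel R ts =>
    refine ⟨0, fun M N _ _ hM hN v xs v' xs' h => ?_⟩
    obtain ⟨s, u, u', hu, hu', huu', -, -, g, h6, h7⟩ := h
    choose x hx using fun j => Lang.term_eq_var (ts j)
    simp only [Language.BoundedFormula.Realize, hx, Language.Term.realize_var, h6, h7]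
    rw [hM.symmIrr.relMap_iff, hN.symmIrr.relMap_iff]
    have h1 : (fun j => (u ∘ g) (x j)) = u ∘ (g ∘ x) := rfl
    have h2 : (fun j => (u' ∘ g) (x j)) = u' ∘ (g ∘ x) := rfl
    rw [h1, h2, ← Finset.image_image, ← Finset.image_image, hu.of_comp_iff, hu'.of_comp_iff,
      huu' _ _]
    simp only [Finset.image_image]
  | imp φ ψ ih₁ ih₂ =>
    obtain ⟨m₁, h₁⟩ := ih₁
    obtain ⟨m₂, h₂⟩ := ih₂
    refine ⟨max m₁ m₂, fun M N _ _ hM hN v xs v' xs' h => ?_⟩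
    rw [Language.BoundedFormula.realize_imp, Language.BoundedFormula.realize_imp,
      h₁ M N hM hN v xs v' xs' (h.mono (le_max_left _ _)),
      h₂ M N hM hN v xs v' xs' (h.mono (le_max_right _ _))]
  | @all n φ ih =>
    obtain ⟨m', h'⟩ := ih
    obtain ⟨m, hm⟩ := exists_locIso_forth (k := k) hα m' (r + n)
    refine ⟨m, fun M N _ _ hM hN v xs v' xs' h => ?_⟩
    have key : ∀ (M N : Type) [(Lang p k).Structure M] [(Lang p k).Structure N],
        AlphaModel k α M → AlphaModel k α N →
        ∀ (v : Fin r → M) (xs : Fin n → M) (v' : Fin r → N) (xs' : Fin n → N),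
        LocIso k α m (Sum.elim v xs) (Sum.elim v' xs') →
          φ.all.Realize v' xs' → φ.all.Realize v xs := by
      intro M N _ _ hM hN v xs v' xs' h hall x
      obtain ⟨x', hx'⟩ := hm M N hM hN (Fin r ⊕ Fin n) (by simp) _ _ h x
      refine (h' M N hM hN v (Fin.snoc xs x) v' (Fin.snoc xs' x') ?_).2 (hall x')
      obtain ⟨s, u, u', h1, h2, h3, h4, h5, g, h6, h7⟩ := hx'
      refine ⟨s, u, u', h1, h2, h3, h4, h5,
        Sum.elim (fun a => g (Sum.inl (Sum.inl a)))
          (Fin.snoc (fun a => g (Sum.inl (Sum.inr a))) (g (Sum.inr ()))), ?_, ?_⟩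
      · funext a
        rcases a with a | a
        · exact congrFun h6 (Sum.inl (Sum.inl a))
        · refine Fin.lastCases ?_ (fun a => ?_) a
          · simpa using congrFun h6 (Sum.inr ())
          · simpa using congrFun h6 (Sum.inl (Sum.inr a))
      · funext a
        rcases a with a | a
        · exact congrFun h7 (Sum.inl (Sum.inl a))
        · refine Fin.lastCases ?_ (fun a => ?_) a
          · simpa using congrFun h7 (Sum.inr ())
          · simpa using congrFun h7 (Sum.inl (Sum.inr a))
    exact ⟨key N M hN hM v' xs' v xs h.symm, key M N hM hN v xs v' xs' h⟩

end BackAndForth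

section Definability

/-- A class of predicates closed under Boolean operations contains every predicate determined by
finitely many of its members. -/
lemma mem_of_determined {X J : Type*} [Finite J] (𝓒 : (X → Prop) → Prop)
    (hnot : ∀ P, 𝓒 P → 𝓒 fun x => ¬ P x) (hand : ∀ P Q, 𝓒 P → 𝓒 Q → 𝓒 fun x => P x ∧ Q x)
    (htrue : 𝓒 fun _ => True) (F : J → X → Prop) (hF : ∀ j, 𝓒 (F j)) (P : X → Prop)
    (hP : ∀ x y, (∀ j, F j x ↔ F j y) → P x → P y) : 𝓒 P := by
  have hall : ∀ {K : Type _} (s : Finset K) (G : K → X → Prop), (∀ j, 𝓒 (G j)) →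
      𝓒 fun x => ∀ j ∈ s, G j x := by
    intro K s G hG
    induction s using Finset.induction_on with
    | empty => simpa using htrue
    | insert a s _ ih => simpa only [Finset.forall_mem_insert] using hand _ _ (hG a) ih
  have := Fintype.ofFinite J
  have hpat : ∀ τ : Set J, 𝓒 fun x => ∀ j ∈ Finset.univ, (F j x ↔ j ∈ τ) := fun τ =>
    hall _ _ fun j => by
      by_cases hj : j ∈ τ
      · simpa only [hj, iff_true] using hF j
      · simpa only [hj, iff_false] using hnot _ (hF j)
  have hex : 𝓒 fun x => ¬ ∀ τ ∈ (Finset.univ : Finset (Set J)).filter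
      (fun τ => ∃ y, P y ∧ ∀ j, F j y ↔ j ∈ τ), ¬ ∀ j ∈ Finset.univ, (F j x ↔ j ∈ τ) :=
    hnot _ (hall _ _ fun τ => hnot _ (hpat τ))
  convert hex using 2 with x
  simp only [Finset.mem_filter, Finset.mem_univ, true_and, forall_const]
  push Not
  constructor
  · intro hx
    exact ⟨{j | F j x}, ⟨x, hx, fun j => Iff.rfl⟩, fun j => Iff.rfl⟩
  · rintro ⟨τ, ⟨y, hy, hyτ⟩, hx⟩
    exact hP y x (fun j => (hyτ j).trans (hx j).symm) hy

/-- A nonempty structure with a distinguished tuple. -/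
structure TupleStr (k : Fin p → ℕ) (ι : Type) where
  /-- The underlying set. -/
  M : Type
  [nonempty : Nonempty M]
  [str : (Lang p k).Structure M]
  /-- The distinguished tuple. -/
  x : ι → M

attribute [instance] TupleStr.nonempty TupleStr.str

/-- The atomic formulas with variables in `ι`. -/
abbrev Atom (k : Fin p → ℕ) (ι : Type) : Type := (ι × ι) ⊕ (Σ i : Fin p, Fin (k i) → ι)

variable {k : Fin p → ℕ} {ι κ : Type}

/-- The truth of an atomic formula at a tuple. -/
def Atom.Holds (a : Atom k ι) {M : Type} [(Lang p k).Structure M] (x : ι → M) : Prop :=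
  match a with
  | Sum.inl e => x e.1 = x e.2
  | Sum.inr s => Language.Structure.RelMap (L := Lang p k)
      (⟨s.1, rfl⟩ : (Lang p k).Relations (k s.1)) (x ∘ s.2)

/-- Two tuples have the same quantifier-free type. -/
def SameQF (k : Fin p → ℕ) {M N : Type} [(Lang p k).Structure M] [(Lang p k).Structure N]
    (x : ι → M) (x' : ι → N) : Prop :=
  ∀ a : Atom k ι, a.Holds x ↔ a.Holds x'

section SameQF

variable {M N : Type} [(Lang p k).Structure M] [(Lang p k).Structure N] {x : ι → M} {x' : ι → N}

lemma SameQF.symm (h : SameQF k x x') : SameQF k x' x := fun a => (h a).symm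

lemma SameQF.eq_iff (h : SameQF k x x') (i j : ι) : x i = x j ↔ x' i = x' j := h (Sum.inl (i, j))

lemma SameQF.comp (h : SameQF k x x') (e : κ → ι) : SameQF k (x ∘ e) (x' ∘ e) := by
  rintro (a | a)
  · exact h (Sum.inl (e a.1, e a.2))
  · exact h (Sum.inr ⟨a.1, e ∘ a.2⟩)

lemma SameQF.holdsOn (h : SameQF k x x') {i : Fin p} {C : Finset ι}
    (hC : HoldsOn k i (C.image x)) : HoldsOn k i (C.image x') := by
  obtain ⟨v, hv, hvC, hR⟩ := hC
  have h1 : ∀ j, ∃ c ∈ C, x c = v j := fun j => by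
    have := hvC ▸ Finset.mem_image_of_mem v (Finset.mem_univ j)
    simpa using this
  choose s hs hsv using h1
  have hxs : x ∘ s = v := funext hsv
  refine ⟨x' ∘ s, fun a b hab => hv ?_, ?_, ?_⟩
  · rw [← hsv, ← hsv]; exact (h.eq_iff _ _).2 hab
  · ext z
    simp only [Finset.mem_image, Finset.mem_univ, true_and, Function.comp]
    constructor
    · rintro ⟨j, rfl⟩; exact ⟨s j, hs j, rfl⟩
    · rintro ⟨c, hc, rfl⟩
      have : x c ∈ Finset.univ.image v := hvC ▸ Finset.mem_image_of_mem x hc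
      obtain ⟨j, -, hj⟩ := Finset.mem_image.1 this
      exact ⟨j, (h.eq_iff _ _).1 ((hsv j).trans hj)⟩
  · exact (h (Sum.inr ⟨i, s⟩)).1 (by simpa only [Atom.Holds, hxs] using hR)

lemma SameQF.sameHyp (h : SameQF k x x') : SameHyp k x x' :=
  fun _ _ => ⟨h.holdsOn, h.symm.holdsOn⟩

lemma SameQF.predim_eq [Nonempty N] (α : Fin p → ℝ) (h : SameQF k x x') (C : Finset ι) :
    predim α (hyp k M) (C.image x) = predim α (hyp k N) (C.image x') := by
  obtain ⟨f, hf⟩ : ∃ f : M → N, ∀ c, f (x c) = x' c := by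
    refine ⟨fun z => if hz : ∃ c, x c = z then x' hz.choose else Classical.arbitrary N,
      fun c => ?_⟩
    have hz : ∃ c', x c' = x c := ⟨c, rfl⟩
    beta_reduce
    rw [dif_pos hz]
    exact (h.eq_iff _ _).1 hz.choose_spec
  have hfx : f ∘ x = x' := funext hf
  rw [← hfx, ← Finset.image_image]
  refine (predim_image ?_ ?_).symm
  · intro a ha b hb hab
    obtain ⟨c, -, rfl⟩ := Finset.mem_image.1 ha
    obtain ⟨d, -, rfl⟩ := Finset.mem_image.1 hb
    rw [hf, hf] at hab
    exact (h.eq_iff _ _).2 hab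
  · intro i D hD
    obtain ⟨D₀, -, rfl⟩ := Finset.subset_image_iff.1 hD
    rw [Finset.image_image, hfx]
    exact (h.sameHyp i D₀).symm

end SameQF

/-- Predicates invariant under equality of quantifier-free types. -/
def QFInvariant (P : TupleStr k ι → Prop) : Prop :=
  ∀ q q' : TupleStr k ι, SameQF k q.x q'.x → P q → P q'

/-- Predicates defined by a formula. -/
def FormulaDefinable (P : TupleStr k ι → Prop) : Prop :=
  ∃ φ : (Lang p k).Formula ι, ∀ q : TupleStr k ι, φ.Realize q.x ↔ P q

/-- The tuple `x` joined with an additional tuple. -/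
abbrev TupleStr.elim (q : TupleStr k ι) (z : κ → q.M) : TupleStr k (ι ⊕ κ) := ⟨q.M, Sum.elim q.x z⟩

lemma QFInvariant.exists_isQF [Finite ι] {n : ℕ} {P : TupleStr k (ι ⊕ Fin n) → Prop}
    (hP : QFInvariant P) : ∃ φ : (Lang p k).BoundedFormula ι n, φ.IsQF ∧
      ∀ (q : TupleStr k ι) (z : Fin n → q.M), φ.Realize q.x z ↔ P (q.elim z) := by
  have key := mem_of_determined (X := TupleStr k (ι ⊕ Fin n)) (J := Atom k (ι ⊕ Fin n))
    (fun Q => ∃ φ : (Lang p k).BoundedFormula ι n, φ.IsQF ∧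
      ∀ q : TupleStr k (ι ⊕ Fin n), φ.Realize (q.x ∘ Sum.inl) (q.x ∘ Sum.inr) ↔ Q q)
    (fun Q ⟨φ, h1, h2⟩ => ⟨φ.not, h1.not, fun q => by
      rw [Language.BoundedFormula.realize_not, h2]⟩)
    (fun Q R ⟨φ, h1, h2⟩ ⟨ψ, h3, h4⟩ => ⟨φ ⊓ ψ, h1.inf h3, fun q => by
      rw [Language.BoundedFormula.realize_inf, h2, h4]⟩)
    ⟨⊤, Language.BoundedFormula.IsQF.top, fun q => by simp⟩
    (fun a q => a.Holds q.x) ?_ P (fun q q' h => hP q q' h)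
  · obtain ⟨φ, h1, h2⟩ := key
    exact ⟨φ, h1, fun q z => by simpa using h2 (q.elim z)⟩
  · rintro (⟨a, b⟩ | ⟨i, s⟩)
    · refine ⟨Language.Term.bdEqual (Language.Term.var a) (Language.Term.var b),
        (Language.BoundedFormula.IsAtomic.equal _ _).isQF, fun q => ?_⟩
      rw [Language.BoundedFormula.realize_bdEqual]
      simp [Atom.Holds]
    · refine ⟨Language.Relations.boundedFormula (L := Lang p k)
        (⟨i, rfl⟩ : (Lang p k).Relations (k i)) (fun j => Language.Term.var (s j)),
        (Language.BoundedFormula.IsAtomic.rel _ _).isQF, fun q => ?_⟩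
      change Language.Structure.RelMap (L := Lang p k) (⟨i, rfl⟩ : (Lang p k).Relations (k i))
        (fun j => Sum.elim (q.x ∘ Sum.inl) (q.x ∘ Sum.inr) (s j)) ↔ _
      rw [Sum.elim_comp_inl_inr]
      rfl

lemma QFInvariant.formulaDefinable [Finite ι] {P : TupleStr k ι → Prop} (hP : QFInvariant P) :
    FormulaDefinable P := by
  obtain ⟨φ, -, hφ⟩ := QFInvariant.exists_isQF (n := 0)
    (P := fun q : TupleStr k (ι ⊕ Fin 0) => P ⟨q.M, q.x ∘ Sum.inl⟩)
    (fun q q' h => hP ⟨q.M, q.x ∘ Sum.inl⟩ ⟨q'.M, q'.x ∘ Sum.inl⟩ (h.comp Sum.inl))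
  exact ⟨φ, fun q => hφ q default⟩

namespace FormulaDefinable

lemma and {P Q : TupleStr k ι → Prop} (hP : FormulaDefinable P) (hQ : FormulaDefinable Q) :
    FormulaDefinable fun q => P q ∧ Q q := by
  obtain ⟨φ, hφ⟩ := hP
  obtain ⟨ψ, hψ⟩ := hQ
  exact ⟨φ ⊓ ψ, fun q => by rw [Language.Formula.realize_inf, hφ, hψ]⟩

lemma imp {P Q : TupleStr k ι → Prop} (hP : FormulaDefinable P) (hQ : FormulaDefinable Q) :
    FormulaDefinable fun q => P q → Q q := by
  obtain ⟨φ, hφ⟩ := hP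
  obtain ⟨ψ, hψ⟩ := hQ
  exact ⟨φ.imp ψ, fun q => by rw [Language.Formula.realize_imp, hφ, hψ]⟩

lemma all [Finite κ] {P : TupleStr k (ι ⊕ κ) → Prop} (hP : FormulaDefinable P) :
    FormulaDefinable fun q : TupleStr k ι => ∀ z : κ → q.M, P (q.elim z) := by
  obtain ⟨φ, hφ⟩ := hP
  exact ⟨φ.iAlls κ, fun q => by
    rw [Language.Formula.realize_iAlls]; exact forall_congr' fun z => hφ (q.elim z)⟩

lemma ex [Finite κ] {P : TupleStr k (ι ⊕ κ) → Prop} (hP : FormulaDefinable P) :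
    FormulaDefinable fun q : TupleStr k ι => ∃ z : κ → q.M, P (q.elim z) := by
  obtain ⟨φ, hφ⟩ := hP
  exact ⟨φ.iExs κ, fun q => by
    rw [Language.Formula.realize_iExs]; exact exists_congr fun z => hφ (q.elim z)⟩

lemma exists_sentence [Finite κ] {P : TupleStr k κ → Prop} (hP : FormulaDefinable P) :
    ∃ σ : (Lang p k).Sentence, ∀ (M : Type) [Nonempty M] [(Lang p k).Structure M],
      M ⊨ σ ↔ ∀ x : κ → M, P ⟨M, x⟩ := by
  obtain ⟨φ, hφ⟩ := hP
  refine ⟨(φ.relabel (Sum.inr : κ → Empty ⊕ κ)).iAlls κ, fun M _ _ => ?_⟩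
  rw [Language.Sentence.Realize, Language.Formula.realize_iAlls]
  refine forall_congr' fun x => ?_
  rw [Language.Formula.realize_relabel]
  exact hφ ⟨M, x⟩

end FormulaDefinable

lemma strongUpTo_iff_tuple {V : Type} {α : Fin p → ℝ} {H : Fin p → Finset V → Prop} {m : ℕ}
    {A : Finset V} : StrongUpTo α H m A ↔
      ∀ z : Fin m → V, predim α H A ≤ predim α H (A ∪ Finset.univ.image z) := by
  constructor
  · intro h z
    refine h _ Finset.subset_union_left ?_
    rw [Finset.union_sdiff_left]
    exact (Finset.card_le_card Finset.sdiff_subset).trans (Finset.card_image_le.trans (by simp))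
  · intro h X hX hc
    rcases (X \ A).eq_empty_or_nonempty with h0 | ⟨c, hc0⟩
    · rw [hX.antisymm (Finset.sdiff_eq_empty_iff_subset.1 h0)]
    · obtain ⟨e, -, he⟩ := exists_enum (X \ A)
      have := h (fun j => if hj : (j : ℕ) < (X \ A).card then e ⟨j, hj⟩ else c)
      convert this using 2
      ext z
      simp only [Finset.mem_union, Finset.mem_image, Finset.mem_univ, true_and]
      constructor
      · intro hz
        by_cases hzA : z ∈ A
        · exact Or.inl hzA
        · have : z ∈ Finset.univ.image e := by rw [he]; exact Finset.mem_sdiff.2 ⟨hz, hzA⟩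
          obtain ⟨j, -, rfl⟩ := Finset.mem_image.1 this
          exact Or.inr ⟨⟨j, j.2.trans_le hc⟩, by simp⟩
      · rintro (hz | ⟨j, rfl⟩)
        · exact hX hz
        · split_ifs with hj
          · exact (Finset.mem_sdiff.1 (he ▸ Finset.mem_image_of_mem e (Finset.mem_univ _))).1
          · exact (Finset.mem_sdiff.1 hc0).1

lemma formulaDefinable_strongUpTo [Fintype ι] (α : Fin p → ℝ) (m : ℕ) :
    FormulaDefinable fun q : TupleStr k ι =>
      StrongUpTo α (hyp k q.M) m (Finset.univ.image q.x) := by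
  have h : FormulaDefinable fun q : TupleStr k (ι ⊕ Fin m) =>
      predim α (hyp k q.M) ((Finset.univ.disjSum ∅).image q.x) ≤
        predim α (hyp k q.M) (Finset.univ.image q.x) := by
    refine QFInvariant.formulaDefinable fun q q' h => ?_
    rw [h.predim_eq α, h.predim_eq α]
    exact id
  obtain ⟨φ, hφ⟩ := h.all
  refine ⟨φ, fun q => ?_⟩
  refine (hφ q).trans (Iff.trans ?_ strongUpTo_iff_tuple.symm)
  refine forall_congr' fun z => ?_
  have h1 : ((Finset.univ : Finset ι).disjSum (∅ : Finset (Fin m))).image (q.elim z).x =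
      Finset.univ.image q.x := by
    ext; simp
  have h2 : Finset.univ.image (q.elim z).x = Finset.univ.image q.x ∪ Finset.univ.image z := by
    ext; simp
  rw [h1, h2]

end Definability

section Existential

variable {k : Fin p → ℕ} {α : Fin p → ℝ}

lemma LocIso.comp {M N : Type} [(Lang p k).Structure M] [(Lang p k).Structure N] {κ κ' : Type}
    {m : ℕ} {v : κ → M} {v' : κ → N} (h : LocIso k α m v v') (f : κ' → κ) :
    LocIso k α m (v ∘ f) (v' ∘ f) := by
  obtain ⟨s, u, u', h1, h2, h3, h4, h5, g, rfl, rfl⟩ := h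
  exact ⟨s, u, u', h1, h2, h3, h4, h5, g ∘ f, rfl, rfl⟩

lemma SameQF.locIso {M N : Type} [(Lang p k).Structure M] [(Lang p k).Structure N] {ι : Type}
    [Fintype ι] {w : ι → M} {w' : ι → N} (h : SameQF k w w') {m : ℕ}
    (hw : StrongUpTo α (hyp k M) m (Finset.univ.image w))
    (hw' : StrongUpTo α (hyp k N) m (Finset.univ.image w')) : LocIso k α m w w' := by
  obtain ⟨e, he, heJ⟩ := exists_enum (Finset.univ.image w)
  have h1 : ∀ j, ∃ c, w c = e j := fun j => by
    have : e j ∈ Finset.univ.image w := heJ ▸ Finset.mem_image_of_mem e (Finset.mem_univ j)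
    simpa using this
  choose t ht using h1
  have h2 : ∀ c, ∃ j, e j = w c := fun c => by
    have : w c ∈ Finset.univ.image e := by
      rw [heJ]; exact Finset.mem_image_of_mem w (Finset.mem_univ c)
    simpa using this
  choose g hg using h2
  have hwg : ∀ c, w (t (g c)) = w c := fun c => (ht _).trans (hg c)
  have hwg' : ∀ c, w' (t (g c)) = w' c := fun c => (h.eq_iff _ _).1 (hwg c)
  have hinj : Function.Injective (w ∘ t) := fun a b hab => he (by
    rw [← ht, ← ht]; exact hab)
  have himg : ∀ {X : Type} (f : ι → X), (∀ c, f (t (g c)) = f c) →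
      Finset.univ.image (f ∘ t) = Finset.univ.image f := fun f hf => by
    ext z
    simp only [Finset.mem_image, Finset.mem_univ, true_and, Function.comp]
    exact ⟨fun ⟨j, hj⟩ => ⟨t j, hj⟩, fun ⟨c, hc⟩ => ⟨g c, by rw [hf, hc]⟩⟩
  refine ⟨_, w ∘ t, w' ∘ t, hinj, fun a b hab => hinj ((h.eq_iff _ _).2 hab),
    (h.comp t).sameHyp, ?_, ?_, g, (funext hwg).symm, (funext hwg').symm⟩
  · rwa [himg w hwg]
  · rwa [himg w' hwg']

/-- Every existential property of bounded length of the tuple `a` also holds of `b`. -/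
def ExTypeLe (k : Fin p → ℕ) {M N : Type} [(Lang p k).Structure M] [(Lang p k).Structure N]
    {ι : Type} (S₀ : ℕ) (a : ι → M) (b : ι → N) : Prop :=
  ∀ S ≤ S₀, ∀ y : Fin S → M, ∃ y' : Fin S → N, SameQF k (Sum.elim a y) (Sum.elim b y')

lemma ExTypeLe.exists_decrease {M N : Type} [Nonempty N] [(Lang p k).Structure M]
    [(Lang p k).Structure N]
    {ι : Type} [Fintype ι] {S₀ : ℕ} {a : ι → M} {b : ι → N} (h : ExTypeLe k S₀ a b)
    {m S : ℕ} (hS : S + m ≤ S₀) {ε : ℝ} (hgap : ∀ A X : Finset M, A ⊆ X → (X \ A).card ≤ m →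
      predim α (hyp k M) X - predim α (hyp k M) A < 0 →
      predim α (hyp k M) X - predim α (hyp k M) A ≤ 0 - ε)
    {y : Fin S → M} (hy : ¬ StrongUpTo α (hyp k M) m (Finset.univ.image (Sum.elim a y))) :
    ∃ (y₂ : Fin (S + m) → M) (y₂' : Fin (S + m) → N),
      SameQF k (Sum.elim a y₂) (Sum.elim b y₂') ∧
      predim α (hyp k M) (Finset.univ.image (Sum.elim a y₂)) ≤
        predim α (hyp k M) (Finset.univ.image (Sum.elim a y)) - ε ∧
      predim α (hyp k N) (Finset.univ.image (Sum.elim b y₂')) =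
        predim α (hyp k M) (Finset.univ.image (Sum.elim a y₂)) := by
  rw [strongUpTo_iff_tuple] at hy
  push Not at hy
  obtain ⟨z, hz⟩ := hy
  obtain ⟨y₂', hy₂'⟩ := h (S + m) hS (Fin.append y z)
  refine ⟨Fin.append y z, y₂', hy₂', ?_, (hy₂'.predim_eq α _).symm⟩
  have himg : Finset.univ.image (Sum.elim a (Fin.append y z)) =
      Finset.univ.image (Sum.elim a y) ∪ Finset.univ.image z := by
    ext c
    simp only [Finset.mem_image, Finset.mem_univ, true_and, Sum.exists, Sum.elim_inl,
      Sum.elim_inr, Finset.mem_union, or_assoc]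
    refine or_congr Iff.rfl ⟨?_, ?_⟩
    · rintro ⟨j, rfl⟩
      refine Fin.addCases (fun j => ?_) (fun j => ?_) j
      · exact Or.inl ⟨j, by rw [Fin.append_left]⟩
      · exact Or.inr ⟨j, by rw [Fin.append_right]⟩
    · rintro (⟨j, rfl⟩ | ⟨j, rfl⟩)
      · exact ⟨Fin.castAdd m j, Fin.append_left _ _ _⟩
      · exact ⟨Fin.natAdd S j, Fin.append_right _ _ _⟩
  rw [himg]
  have := hgap (Finset.univ.image (Sum.elim a y)) _ Finset.subset_union_left (by
    rw [Finset.union_sdiff_left]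
    exact (Finset.card_le_card Finset.sdiff_subset).trans (Finset.card_image_le.trans (by simp)))
    (sub_neg.2 hz)
  linarith

/-- Existential types of bounded length determine local isomorphism. -/
lemma exists_locIso_of_exTypeLe (hα : ∀ i, 0 < α i) (r m : ℕ) :
    ∃ S₀, ∀ (M N : Type) [Nonempty M] [Nonempty N] [(Lang p k).Structure M]
      [(Lang p k).Structure N], AlphaModel k α M → AlphaModel k α N →
      ∀ (a : Fin r → M) (b : Fin r → N), ExTypeLe k S₀ a b → ExTypeLe k S₀ b a →
        LocIso k α m a b := by
  obtain ⟨ε, hε, hgap⟩ := exists_predim_gap hα m 0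
  obtain ⟨J₀, hJ₀⟩ := exists_nat_gt ((r : ℝ) / ε)
  rw [div_lt_iff₀ hε] at hJ₀
  refine ⟨J₀ * m, fun M N _ _ _ _ hM hN a b hab hba => ?_⟩
  have hfin : ∀ (S : ℕ) (y : Fin S → M) (y' : Fin S → N),
      SameQF k (Sum.elim a y) (Sum.elim b y') →
      StrongUpTo α (hyp k M) m (Finset.univ.image (Sum.elim a y)) →
      StrongUpTo α (hyp k N) m (Finset.univ.image (Sum.elim b y')) → LocIso k α m a b :=
    fun S y y' h h1 h2 => (h.locIso h1 h2).comp Sum.inl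
  by_contra hcon
  have key : ∀ J ≤ J₀, ∃ S, S ≤ J * m ∧ ∃ (y : Fin S → M) (y' : Fin S → N),
      SameQF k (Sum.elim a y) (Sum.elim b y') ∧
      predim α (hyp k M) (Finset.univ.image (Sum.elim a y)) ≤ r - J * ε := by
    intro J
    induction J with
    | zero =>
      intro _
      obtain ⟨y', hy'⟩ := hab 0 (Nat.zero_le _) Fin.elim0
      refine ⟨0, Nat.zero_le _, Fin.elim0, y', hy', ?_⟩
      refine (predim_le_card (fun i => (hα i).le) _).trans ?_
      simp only [Nat.cast_zero, zero_mul, sub_zero, Nat.cast_le]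
      exact Finset.card_image_le.trans (by simp)
    | succ J ih =>
      intro hJ
      obtain ⟨S, hS, y, y', hy, hle⟩ := ih (by omega)
      have hSm : S + m ≤ (J + 1) * m := by rw [Nat.succ_mul]; omega
      have hSm' : S + m ≤ J₀ * m := hSm.trans (Nat.mul_le_mul_right m hJ)
      refine ⟨S + m, hSm, ?_⟩
      push_cast
      by_cases h1 : StrongUpTo α (hyp k M) m (Finset.univ.image (Sum.elim a y))
      · by_cases h2 : StrongUpTo α (hyp k N) m (Finset.univ.image (Sum.elim b y'))
        · exact absurd (hfin S y y' hy h1 h2) hcon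
        · obtain ⟨z, z', h3, h4, h5⟩ := hba.exists_decrease hSm' (hgap N (hyp k N)) h2
          rw [← hy.predim_eq α] at h4
          exact ⟨z', z, h3.symm, by linarith⟩
      · obtain ⟨z, z', h3, h4, h5⟩ := hab.exists_decrease hSm' (hgap M (hyp k M)) h1
        exact ⟨z, z', h3, by linarith⟩
  obtain ⟨S, -, y, y', -, hle⟩ := key J₀ le_rfl
  have := hM.nonneg (Finset.univ.image (Sum.elim a y))
  linarith

/-- In the models of the axioms, every formula is equivalent to a Boolean combination of
existential formulas. -/
lemma exists_isBoolCombExistential (hα : ∀ i, 0 < α i) {r : ℕ} (φ : (Lang p k).Formula (Fin r)) :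
    ∃ ψ : (Lang p k).Formula (Fin r), IsBoolCombExistential k ψ ∧
      ∀ (M : Type) [Nonempty M] [(Lang p k).Structure M], AlphaModel k α M →
        ∀ v : Fin r → M, φ.Realize v ↔ ψ.Realize v := by
  obtain ⟨m, hm⟩ := exists_locIso_realize_iff (k := k) hα φ
  obtain ⟨S₀, hS₀⟩ := exists_locIso_of_exTypeLe (k := k) hα r m
  have key := mem_of_determined (X := {q : TupleStr k (Fin r) // AlphaModel k α q.M})
    (J := Σ S : Fin (S₀ + 1), Set (Atom k (Fin r ⊕ Fin S)))
    (fun P => ∃ ψ : (Lang p k).Formula (Fin r), IsBoolCombExistential k ψ ∧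
      ∀ q, P q ↔ ψ.Realize q.1.x)
    (fun P ⟨ψ, h1, h2⟩ => ⟨ψ.not, h1.not, fun q => by 
      rw [Language.Formula.realize_not, ← h2]⟩)
    (fun P Q ⟨ψ, h1, h2⟩ ⟨χ, h3, h4⟩ => ⟨ψ ⊓ χ, h1.inf _ _ h3, fun q => by
      rw [Language.Formula.realize_inf, ← h2, ← h4]⟩)
    ⟨⊤, .of_existential _ ⟨0, ⊤, Language.BoundedFormula.IsQF.top, rfl⟩, fun q => by simp⟩
    (fun j q => ∃ y : Fin j.1 → q.1.M, ∀ a, a.Holds (Sum.elim q.1.x y) ↔ a ∈ j.2) ?_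
    (fun q => φ.Realize q.1.x) ?_
  · obtain ⟨ψ, h1, h2⟩ := key
    exact ⟨ψ, h1, fun M _ _ hM v => h2 ⟨⟨M, v⟩, hM⟩⟩
  · rintro ⟨S, τ⟩
    obtain ⟨ψ, h1, h2⟩ := QFInvariant.exists_isQF
      (P := fun q : TupleStr k (Fin r ⊕ Fin S) => ∀ a, a.Holds q.x ↔ a ∈ τ)
      (fun q q' h hq a => (h a).symm.trans (hq a))
    refine ⟨ψ.exs, .of_existential _ ⟨S, ψ, h1, rfl⟩, fun q => ?_⟩
    exact (exists_congr fun y => (h2 q.1 y).symm).trans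
      Language.BoundedFormula.realize_exs.symm
  · rintro ⟨⟨M, a⟩, hM⟩ ⟨⟨N, b⟩, hN⟩ hF h
    have hle : ∀ (M N : Type) [(Lang p k).Structure M] [(Lang p k).Structure N]
        (a : Fin r → M) (b : Fin r → N),
        (∀ j : Σ S : Fin (S₀ + 1), Set (Atom k (Fin r ⊕ Fin S)),
          (∃ y : Fin j.1 → M, ∀ c, Atom.Holds c (Sum.elim a y) ↔ c ∈ j.2) →
          ∃ y : Fin j.1 → N, ∀ c, Atom.Holds c (Sum.elim b y) ↔ c ∈ j.2) →
        ExTypeLe k S₀ a b := by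
      intro M N _ _ a b hF S hS y
      obtain ⟨y', hy'⟩ := hF ⟨⟨S, by omega⟩, {c | Atom.Holds c (Sum.elim a y)}⟩
        ⟨y, fun c => Iff.rfl⟩
      exact ⟨y', fun c => (hy' c).symm⟩
    have hiso := hS₀ M N hM hN a b (hle M N a b fun j => (hF j).1) (hle N M b a fun j => (hF j).2)
    have := hiso.comp (Sum.elim id Fin.elim0 : Fin r ⊕ Fin 0 → Fin r)
    have hcomp : ∀ {M : Type} (c : Fin r → M),
        c ∘ (Sum.elim id Fin.elim0 : Fin r ⊕ Fin 0 → Fin r) = Sum.elim c default := fun c => by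
      funext j
      rcases j with j | j
      · rfl
      · exact j.elim0
    rw [hcomp, hcomp] at this
    exact (hm M N hM hN a default b default this).1 h

end Existential

section Axioms

variable {k : Fin p → ℕ} {α : Fin p → ℝ}

/-- The extension property for the pattern `B` on `Fin a ⊕ Fin b`. -/
def ExtensionProp (α : Fin p → ℝ) {V : Type} (H : Fin p → Finset V → Prop) {a b : ℕ} (m : ℕ)
    (B : Fin p → Finset (Fin a ⊕ Fin b) → Prop) : Prop :=
  ∀ x : Fin a → V, Function.Injective x →
    (∀ i (C : Finset (Fin a)), H i (C.image x) ↔ B i (C.image Sum.inl)) →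
    StrongUpTo α H (b + m) (Finset.univ.image x) →
    ∃ y : Fin b → V, Function.Injective (Sum.elim x y) ∧
      (∀ i C, H i (C.image (Sum.elim x y)) ↔ B i C) ∧
      StrongUpTo α H m (Finset.univ.image (Sum.elim x y))

lemma exists_sentence_nonneg (k : Fin p → ℕ) (α : Fin p → ℝ) (s : ℕ) :
    ∃ σ : (Lang p k).Sentence,
    ∀ (M : Type) [Nonempty M] [(Lang p k).Structure M],
      M ⊨ σ ↔ ∀ z : Fin s → M, 0 ≤ predim α (hyp k M) (Finset.univ.image z) := by
  have h : FormulaDefinable fun q : TupleStr k (Fin s) =>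
      0 ≤ predim α (hyp k q.M) (Finset.univ.image q.x) :=
    QFInvariant.formulaDefinable fun q q' h => by rw [h.predim_eq α]; exact id
  exact h.exists_sentence

lemma exists_sentence_symmIrr (k : Fin p → ℕ) (i : Fin p) : ∃ σ : (Lang p k).Sentence,
    ∀ (M : Type) [Nonempty M] [(Lang p k).Structure M],
      M ⊨ σ ↔ ∀ x : Fin (k i) → M,
        Language.Structure.RelMap (L := Lang p k) (⟨i, rfl⟩ : (Lang p k).Relations (k i)) x →
        Function.Injective x ∧ ∀ σ : Equiv.Perm (Fin (k i)),
          Language.Structure.RelMap (L := Lang p k) (⟨i, rfl⟩ : (Lang p k).Relations (k i))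
            (x ∘ σ) := by
  have h : FormulaDefinable fun q : TupleStr k (Fin (k i)) =>
      Language.Structure.RelMap (L := Lang p k) (⟨i, rfl⟩ : (Lang p k).Relations (k i)) q.x →
        Function.Injective q.x ∧ ∀ σ : Equiv.Perm (Fin (k i)),
          Language.Structure.RelMap (L := Lang p k) (⟨i, rfl⟩ : (Lang p k).Relations (k i))
            (q.x ∘ σ) := by
    refine QFInvariant.formulaDefinable fun q q' h hq hR => ?_
    obtain ⟨h1, h2⟩ := hq ((h (Sum.inr ⟨i, id⟩)).2 hR)
    exact ⟨fun a b hab => h1 ((h.eq_iff a b).2 hab), fun σ => (h (Sum.inr ⟨i, σ⟩)).1 (h2 σ)⟩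
  exact h.exists_sentence

lemma exists_sentence_extension (k : Fin p → ℕ) (α : Fin p → ℝ) {a b : ℕ} (m : ℕ)
    (B : Fin p → Finset (Fin a ⊕ Fin b) → Prop) :
    ∃ σ : (Lang p k).Sentence, ∀ (M : Type) [Nonempty M] [(Lang p k).Structure M],
      M ⊨ σ ↔ ExtensionProp α (hyp k M) m B := by
  have h1 : FormulaDefinable fun q : TupleStr k (Fin a) => Function.Injective q.x :=
    QFInvariant.formulaDefinable fun q q' h hq c d hcd => hq ((h.eq_iff c d).2 hcd)
  have h2 : FormulaDefinable fun q : TupleStr k (Fin a) =>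
      ∀ i (C : Finset (Fin a)), hyp k q.M i (C.image q.x) ↔ B i (C.image Sum.inl) :=
    QFInvariant.formulaDefinable fun q q' h hq i C => (h.sameHyp i C).symm.trans (hq i C)
  have h3 : FormulaDefinable fun q : TupleStr k (Fin a ⊕ Fin b) => Function.Injective q.x :=
    QFInvariant.formulaDefinable fun q q' h hq c d hcd => hq ((h.eq_iff c d).2 hcd)
  have h4 : FormulaDefinable fun q : TupleStr k (Fin a ⊕ Fin b) =>
      ∀ i C, hyp k q.M i (C.image q.x) ↔ B i C :=
    QFInvariant.formulaDefinable fun q q' h hq i C => (h.sameHyp i C).symm.trans (hq i C)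
  exact (h1.imp (h2.imp ((formulaDefinable_strongUpTo α (b + m)).imp
    (h3.and (h4.and (formulaDefinable_strongUpTo α m))).ex))).exists_sentence

end Axioms

section BernoulliProduct

variable {I : Type*} [Fintype I]

/-- The weight of a point of the cube under the product of Bernoulli distributions. -/
noncomputable def bernWeight (q : I → ℝ) (ω : I → Bool) : ℝ :=
  ∏ e, if ω e = true then q e else 1 - q e

/-- Expectation with respect to the product of Bernoulli distributions. -/
noncomputable def bernEx (q : I → ℝ) (f : (I → Bool) → ℝ) : ℝ :=
  ∑ ω, bernWeight q ω * f ω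

/-- The probability of an event under the product of Bernoulli distributions. -/
noncomputable def bernPr (q : I → ℝ) (Q : (I → Bool) → Prop) : ℝ :=
  bernEx q fun ω => if Q ω then 1 else 0

/-- The parameters are probabilities. -/
def IsProb (q : I → ℝ) : Prop := ∀ e, 0 ≤ q e ∧ q e ≤ 1

variable {q : I → ℝ}

lemma IsProb.bernWeight_nonneg (hq : IsProb q) (ω : I → Bool) : 0 ≤ bernWeight q ω :=
  Finset.prod_nonneg fun e _ => by
    split_ifs
    · exact (hq e).1
    · exact sub_nonneg.2 (hq e).2

lemma IsProb.bernEx_mono (hq : IsProb q) {f g : (I → Bool) → ℝ} (h : ∀ ω, f ω ≤ g ω) :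
    bernEx q f ≤ bernEx q g :=
  Finset.sum_le_sum fun ω _ => mul_le_mul_of_nonneg_left (h ω) (hq.bernWeight_nonneg ω)

lemma bernEx_sum {J : Type*} (s : Finset J) (f : J → (I → Bool) → ℝ) :
    bernEx q (fun ω => ∑ j ∈ s, f j ω) = ∑ j ∈ s, bernEx q (f j) := by
  simp only [bernEx, Finset.mul_sum]
  exact Finset.sum_comm

lemma bernEx_add (f g : (I → Bool) → ℝ) :
    bernEx q (fun ω => f ω + g ω) = bernEx q f + bernEx q g := by
  simp only [bernEx, mul_add, Finset.sum_add_distrib]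

lemma bernEx_const_mul (c : ℝ) (f : (I → Bool) → ℝ) :
    bernEx q (fun ω => c * f ω) = c * bernEx q f := by
  simp only [bernEx, Finset.mul_sum]
  exact Finset.sum_congr rfl fun _ _ => by ring

lemma IsProb.bernEx_nonneg (hq : IsProb q) {f : (I → Bool) → ℝ} (h : ∀ ω, 0 ≤ f ω) :
    0 ≤ bernEx q f :=
  Finset.sum_nonneg fun ω _ => mul_nonneg (hq.bernWeight_nonneg ω) (h ω)

lemma bernPr_subset (F : Finset I) : bernPr q (fun ω => ∀ e ∈ F, ω e = true) = ∏ e ∈ F, q e := by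
  have h1 : bernPr q (fun ω => ∀ e ∈ F, ω e = true) = ∑ ω : I → Bool,
      ∏ e, (fun e (b : Bool) => (if b = true then q e else 1 - q e) *
        if e ∈ F then (if b = true then 1 else 0) else 1) e (ω e) := by
    refine Finset.sum_congr rfl fun ω _ => ?_
    beta_reduce
    rw [Finset.prod_mul_distrib, bernWeight]
    congr 1
    rw [Finset.prod_ite_mem, Finset.univ_inter]
    by_cases h : ∀ e ∈ F, ω e = true
    · rw [if_pos h]
      exact (Finset.prod_eq_one fun e he => by rw [if_pos (h e he)]).symm
    · rw [if_neg h]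
      push Not at h
      obtain ⟨e, he, h⟩ := h
      exact (Finset.prod_eq_zero he (by rw [if_neg h])).symm
  have h2 := (Finset.prod_univ_sum (fun _ : I => (Finset.univ : Finset Bool))
    (fun e (b : Bool) => (if b = true then q e else 1 - q e) *
        if e ∈ F then (if b = true then 1 else 0) else 1)).symm
  rw [Fintype.piFinset_univ] at h2
  refine h1.trans (Eq.trans (Finset.sum_congr ?_ fun _ _ => rfl) (h2.trans ?_))
  · ext; simp
  simp only [Fintype.sum_bool]
  rw [← Finset.univ_inter F, ← Finset.prod_ite_mem]
  refine Finset.prod_congr rfl fun e _ => ?_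
  by_cases he : e ∈ F <;> simp [he]

lemma bernEx_one : bernEx q (fun _ => 1) = 1 := by
  simpa [bernPr] using bernPr_subset (q := q) ∅

lemma bernEx_const (c : ℝ) : bernEx q (fun _ => c) = c := by
  have := bernEx_const_mul (q := q) c (fun _ => 1)
  rwa [bernEx_one, mul_one] at this

/-- The function `f` only depends on the coordinates in `S`. -/
def DependsOnlyOn (f : (I → Bool) → ℝ) (S : Set I) : Prop :=
  ∀ ω ω' : I → Bool, (∀ e ∈ S, ω e = ω' e) → f ω = f ω'

/-- Functions of disjoint sets of coordinates are independent. -/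
lemma bernEx_mul {f g : (I → Bool) → ℝ} {S : Set I} (hf : DependsOnlyOn f S)
    (hg : DependsOnlyOn g Sᶜ) : bernEx q (fun ω => f ω * g ω) = bernEx q f * bernEx q g := by
  set mix : (I → Bool) → (I → Bool) → (I → Bool) := fun ω ω' e => if e ∈ S then ω e else ω' e
    with hmix
  have hmm : ∀ ω ω', mix (mix ω ω') (mix ω' ω) = ω := fun ω ω' => by
    funext e; simp only [hmix]; split_ifs <;> rfl
  let Φ : (I → Bool) × (I → Bool) ≃ (I → Bool) × (I → Bool) :=
    { toFun := fun x => (mix x.1 x.2, mix x.2 x.1)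
      invFun := fun x => (mix x.1 x.2, mix x.2 x.1)
      left_inv := fun x => Prod.ext (hmm _ _) (hmm _ _)
      right_inv := fun x => Prod.ext (hmm _ _) (hmm _ _) }
  have hw : ∀ x : (I → Bool) × (I → Bool), bernWeight q (Φ x).1 * bernWeight q (Φ x).2 =
      bernWeight q x.1 * bernWeight q x.2 := fun x => by
    simp only [bernWeight, ← Finset.prod_mul_distrib]
    refine Finset.prod_congr rfl fun e _ => ?_
    by_cases he : e ∈ S
    · simp [Φ, hmix, he]
    · simp [Φ, hmix, he, mul_comm]
  have h1 : bernEx q (fun ω => f ω * g ω) =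
      ∑ x : (I → Bool) × (I → Bool), bernWeight q x.1 * bernWeight q x.2 * (f x.1 * g x.1) := by
    rw [← mul_one (bernEx q _), ← bernEx_one (q := q)]
    simp only [bernEx, mul_one]
    rw [Finset.sum_mul_sum, Fintype.sum_prod_type]
    exact Finset.sum_congr rfl fun _ _ => Finset.sum_congr rfl fun _ _ => by ring
  rw [h1, ← Φ.sum_comp]
  simp only [bernEx]
  rw [Finset.sum_mul_sum, Fintype.sum_prod_type]
  refine Finset.sum_congr rfl fun ω _ => Finset.sum_congr rfl fun ω' _ => ?_
  rw [hw]
  have h2 : f (Φ (ω, ω')).1 = f ω := hf _ _ fun e he => by simp [Φ, hmix, he]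
  have h3 : g (Φ (ω, ω')).1 = g ω' := hg _ _ fun e he => by
    simp [Φ, hmix, (show e ∉ S from he)]
  rw [h2, h3]
  ring

lemma bernEx_prod {J : Type*} (s : Finset J) (f : J → (I → Bool) → ℝ) (S : J → Set I)
    (hf : ∀ j, DependsOnlyOn (f j) (S j)) (hS : ∀ i j, i ≠ j → Disjoint (S i) (S j)) :
    bernEx q (fun ω => ∏ j ∈ s, f j ω) = ∏ j ∈ s, bernEx q (f j) := by
  induction s using Finset.induction_on with
  | empty => simpa using bernEx_one
  | insert a s ha ih =>
    simp only [Finset.prod_insert ha]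
    rw [bernEx_mul (S := S a) (hf a), ih]
    intro ω ω' h
    refine Finset.prod_congr rfl fun j hj => hf j _ _ fun e he => h e ?_
    exact fun h' => Set.disjoint_left.1 (hS a j (fun h => ha (h ▸ hj))) h' he

lemma IsProb.bernPr_mono (hq : IsProb q) {P Q : (I → Bool) → Prop} (h : ∀ ω, P ω → Q ω) :
    bernPr q P ≤ bernPr q Q :=
  hq.bernEx_mono fun ω => by
    by_cases hP : P ω
    · simp [hP, h ω hP]
    · simp only [hP, if_false]; split_ifs <;> norm_num

lemma IsProb.bernPr_nonneg (hq : IsProb q) (P : (I → Bool) → Prop) : 0 ≤ bernPr q P :=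
  hq.bernEx_nonneg fun ω => by split_ifs <;> norm_num

lemma bernPr_not (P : (I → Bool) → Prop) : bernPr q (fun ω => ¬ P ω) = 1 - bernPr q P := by
  rw [eq_sub_iff_add_eq, bernPr, bernPr, ← bernEx_add]
  refine Eq.trans ?_ (bernEx_one (q := q))
  congr 1
  funext ω
  by_cases h : P ω <;> simp [h]

lemma IsProb.bernPr_exists_le {J : Type*} (hq : IsProb q) (s : Finset J)
    (P : J → (I → Bool) → Prop) :
    bernPr q (fun ω => ∃ j ∈ s, P j ω) ≤ ∑ j ∈ s, bernPr q (P j) := by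
  simp only [bernPr]
  rw [← bernEx_sum]
  refine hq.bernEx_mono fun ω => ?_
  have h0 : ∀ j ∈ s, (0 : ℝ) ≤ if P j ω then 1 else 0 := fun j _ => by split_ifs <;> norm_num
  split_ifs with h
  · obtain ⟨j, hj, hP⟩ := h
    refine le_trans ?_ (Finset.single_le_sum h0 hj)
    simp [hP]
  · exact Finset.sum_nonneg h0

lemma IsProb.bernPr_or_le (hq : IsProb q) (P Q : (I → Bool) → Prop) :
    bernPr q (fun ω => P ω ∨ Q ω) ≤ bernPr q P + bernPr q Q := by
  rw [bernPr, bernPr, bernPr, ← bernEx_add]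
  refine hq.bernEx_mono fun ω => ?_
  by_cases h1 : P ω <;> by_cases h2 : Q ω <;> simp [h1, h2]

/-- Markov's inequality. -/
lemma IsProb.mul_bernPr_le (hq : IsProb q) {c : ℝ} {P : (I → Bool) → Prop} {f : (I → Bool) → ℝ}
    (hf : ∀ ω, 0 ≤ f ω) (h : ∀ ω, P ω → c ≤ f ω) : c * bernPr q P ≤ bernEx q f := by
  rw [bernPr, ← bernEx_const_mul]
  refine hq.bernEx_mono fun ω => ?_
  split_ifs with hP
  · simpa using h ω hP
  · simpa using hf ω

end BernoulliProduct

section RandomHypergraph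

/-- The edge probabilities of the random structure. -/
noncomputable def edgeProb (k : Fin p → ℕ) (α γ : Fin p → ℝ) (V : Type) [Fintype V] :
    Fin p × Finset V → ℝ :=
  fun e => if e.2.card = k e.1 then γ e.1 * (Fintype.card V : ℝ) ^ (-(α e.1)) else 0

/-- The hypergraph of a configuration. -/
def cfgHyp {V : Type} (ω : Fin p × Finset V → Bool) : Fin p → Finset V → Prop :=
  fun i C => ω (i, C) = true

variable {k : Fin p → ℕ} {α γ : Fin p → ℝ}

lemma Pev_eq_bernPr (n : ℕ) (Q : Config p n → Prop)
    (Q' : (Fin p × Finset (Fin n) → Bool) → Prop)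
    (hQ : ∀ E ∈ validE k n, Q E ↔ Q' (fun e => E e.1 e.2)) :
    Pev k α γ n Q = bernPr (edgeProb k α γ (Fin n)) Q' := by
  refine Finset.sum_of_injOn (fun E e => E e.1 e.2) ?_ (fun _ _ => by simp) ?_ ?_
  · intro E _ E' _ h
    funext i C
    exact congrFun h (i, C)
  · intro ω _ hω
    have : ∃ e : Fin p × Finset (Fin n), ω e = true ∧ e.2.card ≠ k e.1 := by
      by_contra! hcon
      refine hω ⟨fun i C => ω (i, C), ?_, rfl⟩
      simpa [validE] using fun i C h => hcon (i, C) h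
    obtain ⟨e, he, hC⟩ := this
    rw [bernWeight, Finset.prod_eq_zero (Finset.mem_univ e)
      (by rw [if_pos he]; simp [edgeProb, hC]), zero_mul]
  · intro E hE
    have hE' : ∀ i C, E i C = true → C.card = k i := by
      simpa only [validE, Finset.mem_filter, Finset.mem_univ, true_and] using hE
    have hw : weight k α γ n E = bernWeight (edgeProb k α γ (Fin n)) fun e => E e.1 e.2 := by
      rw [weight, bernWeight, Fintype.prod_prod_type]
      refine Finset.prod_congr rfl fun i _ => ?_
      rw [Finset.prod_filter]
      refine Finset.prod_congr rfl fun C _ => ?_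
      by_cases hC : C.card = k i
      · simp only [edgeProb, hC, if_true, Fintype.card_fin]
      · have : E i C ≠ true := fun h => hC (hE' i C h)
        simp [edgeProb, hC, this]
    beta_reduce
    rw [hw]
    by_cases h : Q E
    · rw [if_pos h, if_pos ((hQ E hE).1 h), mul_one]
    · rw [if_neg h, if_neg (fun h' => h ((hQ E hE).2 h')), mul_zero]

lemma rpow_neg_le_one {n : ℕ} (hn : 1 ≤ n) {c : ℝ} (hc : 0 ≤ c) : (n : ℝ) ^ (-c) ≤ 1 :=
  Real.rpow_le_one_of_one_le_of_nonpos (by exact_mod_cast hn) (by linarith)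

variable {V : Type} [Fintype V]

lemma edgeProb_nonneg (hγ : ∀ i, 0 < γ i ∧ γ i ≤ 1) (e : Fin p × Finset V) :
    0 ≤ edgeProb k α γ V e := by
  unfold edgeProb
  split_ifs
  · exact mul_nonneg (hγ _).1.le (Real.rpow_nonneg (Nat.cast_nonneg _) _)
  · rfl

lemma edgeProb_le (hγ : ∀ i, 0 < γ i ∧ γ i ≤ 1) (e : Fin p × Finset V) :
    edgeProb k α γ V e ≤ (Fintype.card V : ℝ) ^ (-(α e.1)) := by
  unfold edgeProb
  have := Real.rpow_nonneg (Nat.cast_nonneg (Fintype.card V) : (0 : ℝ) ≤ _) (-(α e.1))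
  split_ifs
  · exact mul_le_of_le_one_left this (hγ _).2
  · exact this

lemma isProb_edgeProb [Nonempty V] (hα : ∀ i, 0 < α i) (hγ : ∀ i, 0 < γ i ∧ γ i ≤ 1) :
    IsProb (edgeProb k α γ V) := fun e =>
  ⟨edgeProb_nonneg hγ e, (edgeProb_le hγ e).trans
    (rpow_neg_le_one Fintype.card_pos (hα e.1).le)⟩

lemma hyp_structOf (n : ℕ) (E : Config p n) (hE : E ∈ validE k n) :
    (letI := structOf k n E; hyp k (Fin n)) = cfgHyp fun e => E e.1 e.2 := by
  have hE' : ∀ i C, E i C = true → C.card = k i := by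
    simpa only [validE, Finset.mem_filter, Finset.mem_univ, true_and] using hE
  funext i C
  apply propext
  constructor
  · rintro ⟨v, hv, rfl, -, h⟩
    change E i _ = true
    convert h
  · intro h
    have hc := hE' i C h
    set v : Fin (k i) → Fin n := fun j => (C.equivFinOfCardEq hc).symm j with hv
    have himg : Finset.univ.image v = C := by
      ext x
      simp only [Finset.mem_image, Finset.mem_univ, true_and]
      constructor
      · rintro ⟨j, rfl⟩; exact ((C.equivFinOfCardEq hc).symm j).2
      · intro hx; exact ⟨C.equivFinOfCardEq hc ⟨x, hx⟩, by simp [hv]⟩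
    have hinj : Function.Injective v := fun a b hab =>
      (C.equivFinOfCardEq hc).symm.injective (Subtype.ext hab)
    refine ⟨v, hinj, ?_, hinj, ?_⟩
    · convert himg
    · rw [himg]; exact h

end RandomHypergraph

section UpperBounds

variable {k : Fin p → ℕ} {α γ : Fin p → ℝ} {V : Type} [Fintype V]

/-- All sets enumerated by `s`-tuples have nonnegative predimension. -/
def NonnegUpTo (α : Fin p → ℝ) (H : Fin p → Finset V → Prop) (s : ℕ) : Prop :=
  ∀ z : Fin s → V, 0 ≤ predim α H (Finset.univ.image z)

lemma prod_edgeProb_le [Nonempty V] (hγ : ∀ i, 0 < γ i ∧ γ i ≤ 1) (F : Finset (Fin p × Finset V)) :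
    ∏ e ∈ F, edgeProb k α γ V e ≤ (Fintype.card V : ℝ) ^ (-∑ e ∈ F, α e.1) := by
  have hpos : (0 : ℝ) < Fintype.card V := by exact_mod_cast Fintype.card_pos
  rw [← Finset.sum_neg_distrib, Real.rpow_sum_of_pos hpos]
  exact Finset.prod_le_prod (fun e _ => edgeProb_nonneg hγ e) fun e _ => edgeProb_le hγ e

lemma sum_filter_eq_sum_card {V : Type} {S : Finset (Fin p × Finset V)}
    (T : Fin p → Finset (Finset V))
    (h : ∀ i C, (i, C) ∈ S ↔ C ∈ T i) : ∑ e ∈ S, α e.1 = ∑ i, α i * ((T i).card : ℝ) := by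
  rw [Finset.sum_finset_product S Finset.univ T (fun e => by simp [← h])]
  refine Finset.sum_congr rfl fun i _ => ?_
  simp [mul_comm]

/-- The probability that a given set has small predimension over a subset. -/
lemma bernPr_predim_sub_le [Nonempty V] (hα : ∀ i, 0 < α i) (hγ : ∀ i, 0 < γ i ∧ γ i ≤ 1)
    {A W : Finset V} (hAW : A ⊆ W) {N : ℕ} (hN : W.card ≤ N) (c : ℝ) :
    bernPr (edgeProb k α γ V)
      (fun ω => predim α (cfgHyp ω) W - predim α (cfgHyp ω) A ≤ c) ≤
      2 ^ (p * 2 ^ N) * (Fintype.card V : ℝ) ^ (c - (W \ A).card) := by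
  have hq : IsProb (edgeProb k α γ V) := isProb_edgeProb hα hγ
  have hpos : (1 : ℝ) ≤ Fintype.card V := by exact_mod_cast Fintype.card_pos
  set S : Finset (Fin p × Finset V) := Finset.univ ×ˢ W.powerset with hS
  set G := S.powerset.filter fun F => ((W \ A).card : ℝ) - c ≤ ∑ e ∈ F, α e.1 with hG
  have h1 : bernPr (edgeProb k α γ V)
      (fun ω => predim α (cfgHyp ω) W - predim α (cfgHyp ω) A ≤ c) ≤
      bernPr (edgeProb k α γ V) (fun ω => ∃ F ∈ G, ∀ e ∈ F, ω e = true) := by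
    refine hq.bernPr_mono fun ω hω => ?_
    refine ⟨S.filter fun e => ω e = true ∧ ¬ e.2 ⊆ A, ?_, fun e he => ?_⟩
    · rw [hG, Finset.mem_filter, Finset.mem_powerset]
      refine ⟨Finset.filter_subset _ _, ?_⟩
      rw [predim_sub_eq hAW] at hω
      rw [sum_filter_eq_sum_card
        (fun i => edgesIn (cfgHyp ω) i W \ edgesIn (cfgHyp ω) i A)]
      · linarith
      · intro i C
        simp only [hS, Finset.mem_filter, Finset.mem_product, Finset.mem_univ, true_and,
          Finset.mem_powerset, edgesIn, Finset.mem_sdiff, cfgHyp]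
        tauto
    · exact (Finset.mem_filter.1 he).2.1
  refine h1.trans ((hq.bernPr_exists_le _ _).trans ?_)
  have h2 : ∀ F ∈ G, bernPr (edgeProb k α γ V) (fun ω => ∀ e ∈ F, ω e = true) ≤
      (Fintype.card V : ℝ) ^ (c - (W \ A).card) := fun F hF => by
    rw [bernPr_subset]
    refine (prod_edgeProb_le hγ F).trans (Real.rpow_le_rpow_of_exponent_le hpos ?_)
    have := (Finset.mem_filter.1 hF).2
    linarith
  refine (Finset.sum_le_card_nsmul _ _ _ h2).trans ?_
  rw [nsmul_eq_mul]
  refine mul_le_mul_of_nonneg_right ?_ (Real.rpow_nonneg (by linarith) _)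
  have h3 : G.card ≤ 2 ^ (p * 2 ^ N) := by
    refine (Finset.card_filter_le _ _).trans ?_
    rw [Finset.card_powerset, hS, Finset.card_product, Finset.card_powerset, Finset.card_univ,
      Fintype.card_fin]
    gcongr <;> norm_num
  exact_mod_cast h3

lemma sum_inv_card_pow_le [Nonempty V] (A : Finset V) (s : ℕ) :
    ∑ z : Fin s → V, ((Fintype.card V : ℝ)⁻¹) ^ (Finset.univ.image z \ A).card ≤
      (A.card + s + 1 : ℝ) ^ s := by
  induction s with
  | zero => simp
  | succ s ih =>
    have hpos : (0 : ℝ) < Fintype.card V := by exact_mod_cast Fintype.card_pos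
    set n : ℝ := ((Fintype.card V : ℕ) : ℝ) with hn
    rw [← (Fin.consEquiv fun _ => V).sum_comp, Fintype.sum_prod_type_right]
    have h1 : ∀ z : Fin s → V, ∑ v : V,
        n⁻¹ ^ (Finset.univ.image (Fin.consEquiv (fun _ => V) (v, z)) \ A).card ≤
        n⁻¹ ^ (Finset.univ.image z \ A).card * (A.card + s + 1) := fun z => by
      have h2 : ∀ v : V, n⁻¹ ^ (Finset.univ.image (Fin.consEquiv (fun _ => V) (v, z)) \ A).card ≤
          n⁻¹ ^ (Finset.univ.image z \ A).card *
            ((if v ∈ A ∪ Finset.univ.image z then 1 else 0) + n⁻¹) := fun v => by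
        have himg : Finset.univ.image (Fin.consEquiv (fun _ => V) (v, z)) =
            insert v (Finset.univ.image z) := by
          ext u
          simp [Fin.consEquiv, Fin.exists_fin_succ, eq_comm]
        rw [himg]
        by_cases hv : v ∈ A ∪ Finset.univ.image z
        · have : insert v (Finset.univ.image z) \ A = Finset.univ.image z \ A := by
            ext u
            rw [Finset.mem_union] at hv
            simp only [Finset.mem_sdiff, Finset.mem_insert]
            constructor
            · rintro ⟨rfl | h, h'⟩
              · exact ⟨hv.resolve_left h', h'⟩
              · exact ⟨h, h'⟩
            · exact fun h => ⟨Or.inr h.1, h.2⟩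
          rw [this, if_pos hv]
          refine le_mul_of_one_le_right (by positivity) ?_
          have : 0 ≤ n⁻¹ := by positivity
          linarith
        · rw [Finset.mem_union, not_or] at hv
          rw [Finset.insert_sdiff_of_notMem _ hv.1, Finset.card_insert_of_notMem
            (fun h => hv.2 (Finset.mem_sdiff.1 h).1), pow_succ, if_neg (by
              rw [Finset.mem_union]; tauto), zero_add]
      refine (Finset.sum_le_sum fun v _ => h2 v).trans ?_
      rw [← Finset.mul_sum]
      refine mul_le_mul_of_nonneg_left ?_ (by positivity)
      rw [Finset.sum_add_distrib, Finset.sum_const, Finset.card_univ, nsmul_eq_mul,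
        mul_inv_cancel₀ hpos.ne', Finset.sum_ite_mem, Finset.univ_inter, Finset.sum_const,
        nsmul_eq_mul, mul_one]
      have h3 : (A ∪ Finset.univ.image z).card ≤ A.card + s :=
        (Finset.card_union_le _ _).trans (by
          have := Finset.card_image_le (s := Finset.univ) (f := z)
          simp only [Finset.card_univ, Fintype.card_fin] at this
          omega)
      have h4 : ((A ∪ Finset.univ.image z).card : ℝ) ≤ A.card + s := by exact_mod_cast h3
      linarith
    refine (Finset.sum_le_sum fun z _ => h1 z).trans ?_
    rw [← Finset.sum_mul, pow_succ]
    push_cast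
    gcongr
    · refine ih.trans ?_
      gcongr
      linarith
    · linarith

/-- The expected number of tuples of small predimension over a set. -/
lemma sum_bernPr_predim_sub_le [Nonempty V] (hα : ∀ i, 0 < α i) (hγ : ∀ i, 0 < γ i ∧ γ i ≤ 1)
    (A : Finset V) (s : ℕ) (c : ℝ) :
    ∑ z : Fin s → V, bernPr (edgeProb k α γ V)
      (fun ω => predim α (cfgHyp ω) (A ∪ Finset.univ.image z) - predim α (cfgHyp ω) A ≤ c) ≤
      2 ^ (p * 2 ^ (A.card + s)) * (A.card + s + 1) ^ s * (Fintype.card V : ℝ) ^ c := by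
  have hpos : (0 : ℝ) < Fintype.card V := by exact_mod_cast Fintype.card_pos
  have h1 : ∀ z : Fin s → V, bernPr (edgeProb k α γ V)
      (fun ω => predim α (cfgHyp ω) (A ∪ Finset.univ.image z) - predim α (cfgHyp ω) A ≤ c) ≤
      2 ^ (p * 2 ^ (A.card + s)) * (Fintype.card V : ℝ) ^ c *
        ((Fintype.card V : ℝ)⁻¹) ^ (Finset.univ.image z \ A).card := fun z => by
    refine (bernPr_predim_sub_le hα hγ Finset.subset_union_left (N := A.card + s) ?_ c).trans ?_
    · refine (Finset.card_union_le _ _).trans ?_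
      have := Finset.card_image_le (s := Finset.univ) (f := z)
      simp only [Finset.card_univ, Fintype.card_fin] at this
      omega
    · rw [Finset.union_sdiff_left, Real.rpow_sub hpos, Real.rpow_natCast, inv_pow, mul_assoc,
        div_eq_mul_inv]
  refine (Finset.sum_le_sum fun z _ => h1 z).trans ?_
  rw [← Finset.mul_sum, mul_right_comm]
  gcongr
  exact sum_inv_card_pow_le A s

lemma exists_bernPr_not_nonneg_le (hα : ∀ i, 0 < α i) (hγ : ∀ i, 0 < γ i ∧ γ i ≤ 1) (s : ℕ) :
    ∃ ε : ℝ, 0 < ε ∧ ∃ K : ℝ, ∀ (V : Type) [Fintype V] [Nonempty V],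
      bernPr (edgeProb k α γ V) (fun ω => ¬ NonnegUpTo α (cfgHyp ω) s) ≤
        ∑ i, (Fintype.card V : ℝ) ^ (-α i) + K * (Fintype.card V : ℝ) ^ (-ε) := by
  obtain ⟨ε, hε, hgap⟩ := exists_predim_gap hα s 0
  refine ⟨ε, hε, 2 ^ (p * 2 ^ s) * (s + 1) ^ s, fun V _ _ => ?_⟩
  have hq : IsProb (edgeProb k α γ V) := isProb_edgeProb hα hγ
  have h1 : ∀ ω : Fin p × Finset V → Bool, ¬ NonnegUpTo α (cfgHyp ω) s →
      (∃ i ∈ (Finset.univ : Finset (Fin p)), ∀ e ∈ ({(i, ∅)} : Finset (Fin p × Finset V)),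
        ω e = true) ∨
      ∃ z ∈ (Finset.univ : Finset (Fin s → V)), predim α (cfgHyp ω) (∅ ∪ Finset.univ.image z) -
        predim α (cfgHyp ω) ∅ ≤ -ε := by
    intro ω hω
    by_contra! hcon
    refine hω fun z => ?_
    have h0 : predim α (cfgHyp ω) ∅ = 0 := by
      have : ∀ i, edgesIn (cfgHyp ω) i ∅ = ∅ := fun i => by
        ext C
        simp only [edgesIn, Finset.mem_filter, Finset.mem_powerset, Finset.subset_empty,
          Finset.notMem_empty, iff_false]
        rintro ⟨rfl, h⟩
        obtain ⟨e, he, h'⟩ := hcon.1 i (Finset.mem_univ _)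
        rw [Finset.mem_singleton.1 he] at h'
        exact h' h
      simp [predim, this]
    have h2 := hcon.2 z (Finset.mem_univ _)
    rw [Finset.empty_union] at h2
    by_contra! hlt
    have := hgap V (cfgHyp ω) ∅ (Finset.univ.image z) (Finset.empty_subset _) (by
      simpa using Finset.card_image_le (s := Finset.univ) (f := z)) (by rw [h0]; linarith)
    linarith
  refine (hq.bernPr_mono h1).trans ((hq.bernPr_or_le _ _).trans (add_le_add ?_ ?_))
  · refine (hq.bernPr_exists_le _ _).trans (Finset.sum_le_sum fun i _ => ?_)
    rw [bernPr_subset, Finset.prod_singleton]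
    exact edgeProb_le hγ _
  · refine (hq.bernPr_exists_le _ _).trans ?_
    simpa using sum_bernPr_predim_sub_le hα hγ (k := k) (∅ : Finset V) s (-ε)

end UpperBounds

section SecondMoment

variable {I : Type*} [Fintype I] {q : I → ℝ} {b ℓ : ℕ}

/-- The number of members of a family of sets that are present in a configuration. -/
noncomputable def presentCount {I J : Type*} [Fintype J] (E : J → Finset I) (ω : I → Bool) : ℕ :=
  (Finset.univ.filter fun y => ∀ e ∈ E y, ω e = true).card

lemma bernEx_sub_sq {J : Type*} [Fintype J] (E : J → Finset I) {Q : ℝ}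
    (hQ : ∀ y, ∏ e ∈ E y, q e = Q) :
    bernEx q (fun ω => ((presentCount E ω : ℝ) -
      Fintype.card J * Q) ^ 2) = ∑ y, ∑ y', (∏ e ∈ E y ∪ E y', q e - Q ^ 2) := by
  have h1 : (fun ω => ((presentCount E ω : ℝ) -
      Fintype.card J * Q) ^ 2) = fun ω : I → Bool =>
      (∑ y, ∑ y', if ∀ e ∈ E y ∪ E y', ω e = true then (1 : ℝ) else 0) +
        ((-2 * (Fintype.card J * Q)) * (∑ y, if ∀ e ∈ E y, ω e = true then (1 : ℝ) else 0) +
          (Fintype.card J * Q) ^ 2) := by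
    funext ω
    have h2 : (presentCount E ω : ℝ) =
        ∑ y, if ∀ e ∈ E y, ω e = true then (1 : ℝ) else 0 := by
      simp [presentCount]
      congr
    have h3 : ∀ y y', (if ∀ e ∈ E y ∪ E y', ω e = true then (1 : ℝ) else 0) =
        (if ∀ e ∈ E y, ω e = true then (1 : ℝ) else 0) *
          (if ∀ e ∈ E y', ω e = true then (1 : ℝ) else 0) := fun y y' => by
      simp only [Finset.mem_union, or_imp, forall_and]
      by_cases h1 : ∀ e ∈ E y, ω e = true <;> by_cases h2 : ∀ e ∈ E y', ω e = true
      · rw [if_pos ⟨h1, h2⟩, if_pos h1, if_pos h2, mul_one]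
      · rw [if_neg fun h => h2 h.2, if_neg h2, mul_zero]
      · rw [if_neg fun h => h1 h.1, if_neg h1, zero_mul]
      · rw [if_neg fun h => h1 h.1, if_neg h1, zero_mul]
    simp only [h2, h3, ← Finset.sum_mul_sum]
    ring
  rw [h1, bernEx_add, bernEx_add, bernEx_const_mul, bernEx_const, bernEx_sum, bernEx_sum]
  simp only [bernEx_sum]
  have h4 : ∀ F : Finset I, bernEx q (fun ω => if ∀ e ∈ F, ω e = true then (1 : ℝ) else 0) =
      ∏ e ∈ F, q e := fun F => by
    rw [← bernPr_subset, bernPr]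
    congr!
  simp only [h4, hQ, Finset.sum_sub_distrib, Finset.sum_const, Finset.card_univ, nsmul_eq_mul]
  ring

/-- The variance of the number of present sets in a family indexed by tuples, when the overlap of
two members is controlled by the set of coordinates on which the indices agree. -/
lemma IsProb.bernEx_sub_sq_le (hq : IsProb q) (E : (Fin b → Fin ℓ) → Finset I) {Q K : ℝ}
    (hK : 0 < K) (hQ : ∀ y, ∏ e ∈ E y, q e = Q)
    (hdisj : ∀ y y', (∀ j, y j ≠ y' j) → Disjoint (E y) (E y'))
    (hover : ∀ y y', (∃ j, y j = y' j) → ∃ F : Finset I, (∀ e ∈ E y, e ∈ E y' → e ∈ F) ∧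
      K ≤ (ℓ : ℝ) ^ (Finset.univ.filter fun j => y j = y' j).card * ∏ e ∈ F, q e) :
    bernEx q (fun ω => ((presentCount E ω : ℝ) -
      (ℓ : ℝ) ^ b * Q) ^ 2) ≤ 2 ^ b / K * ((ℓ : ℝ) ^ b * Q) ^ 2 := by
  have h := bernEx_sub_sq E hQ
  simp only [Fintype.card_fun, Fintype.card_fin, Nat.cast_pow] at h
  rw [h]
  have h1 : ∀ y y', ∏ e ∈ E y ∪ E y', q e - Q ^ 2 ≤
      Q ^ 2 / K * ∏ j, if y j = y' j then (ℓ : ℝ) else 1 := by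
    intro y y'
    have h2 := Finset.prod_union_inter (s₁ := E y) (s₂ := E y') (f := q)
    rw [hQ, hQ, ← sq] at h2
    have h3 : 0 ≤ Q ^ 2 / K * ∏ j, if y j = y' j then (ℓ : ℝ) else 1 :=
      mul_nonneg (by positivity) (Finset.prod_nonneg fun j _ => by split_ifs <;> positivity)
    by_cases hj : ∃ j, y j = y' j
    · rw [Finset.prod_ite, Finset.prod_const, Finset.prod_const_one, mul_one] at h3 ⊢
      obtain ⟨F, hF, hKF⟩ := hover y y' hj
      have hsub : E y ∩ E y' ⊆ F := fun e he =>
        hF e (Finset.mem_inter.1 he).1 (Finset.mem_inter.1 he).2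
      have hle : ∏ e ∈ F, q e ≤ ∏ e ∈ E y ∩ E y', q e := by
        rw [← Finset.prod_sdiff hsub]
        exact mul_le_of_le_one_left (Finset.prod_nonneg fun e _ => (hq e).1)
          (Finset.prod_le_one (fun e _ => (hq e).1) fun e _ => (hq e).2)
      have h4 := hKF.trans (mul_le_mul_of_nonneg_left hle (by positivity))
      set c := (ℓ : ℝ) ^ (Finset.univ.filter fun j => y j = y' j).card
      set d := ∏ e ∈ E y ∩ E y', q e
      set u := ∏ e ∈ E y ∪ E y', q e
      have hu : 0 ≤ u := Finset.prod_nonneg fun e _ => (hq e).1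
      have hc : 0 ≤ c := by positivity
      have : u * K ≤ Q ^ 2 * c := by
        rw [← h2]
        nlinarith [mul_le_mul_of_nonneg_left h4 hu]
      have h5 : u ≤ Q ^ 2 / K * c := by
        rw [div_mul_eq_mul_div, le_div_iff₀ hK]
        exact this
      linarith [sq_nonneg Q]
    · push Not at hj
      rw [Finset.disjoint_iff_inter_eq_empty.1 (hdisj y y' hj), Finset.prod_empty, mul_one] at h2
      linarith
  refine (Finset.sum_le_sum fun y _ => Finset.sum_le_sum fun y' _ => h1 y y').trans ?_
  have h2 : ∀ y : Fin b → Fin ℓ, ∑ y' : Fin b → Fin ℓ, ∏ j, (if y j = y' j then (ℓ : ℝ) else 1) ≤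
      (2 * ℓ : ℝ) ^ b := by
    intro y
    have h3 := Finset.prod_univ_sum (fun _ : Fin b => (Finset.univ : Finset (Fin ℓ)))
      (fun j v => if y j = v then (ℓ : ℝ) else 1)
    rw [Fintype.piFinset_univ] at h3
    refine le_trans (le_of_eq (Eq.trans ?_ h3.symm)) ?_
    · refine Finset.sum_congr ?_ fun _ _ => rfl
      ext; simp
    · have h5 : (2 * ℓ : ℝ) ^ b = ∏ _j : Fin b, (2 * ℓ : ℝ) := by simp
      rw [h5]
      refine Finset.prod_le_prod (fun j _ => Finset.sum_nonneg fun v _ => by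
        split_ifs <;> positivity) fun j _ => ?_
      have h4 : ∀ v : Fin ℓ, (if y j = v then (ℓ : ℝ) else 1) ≤
          (if y j = v then (ℓ : ℝ) else 0) + 1 := fun v => by
        split_ifs <;> linarith
      refine (Finset.sum_le_sum fun v _ => h4 v).trans ?_
      rw [Finset.sum_add_distrib, Finset.sum_ite_eq]
      simp
      linarith
  simp only [← Finset.mul_sum]
  refine (mul_le_mul_of_nonneg_left (Finset.sum_le_sum fun y _ => h2 y) (by positivity)).trans ?_
  rw [Finset.sum_const, Finset.card_univ, nsmul_eq_mul]
  simp only [Fintype.card_fun, Fintype.card_fin, Nat.cast_pow]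
  refine le_of_eq ?_
  rw [mul_pow]
  ring

/-- Several independent copies of the counting problem are unlikely to all fail. -/
lemma IsProb.bernPr_forall_lt_le (hq : IsProb q) {T : ℕ}
    (E : Fin T → (Fin b → Fin ℓ) → Finset I) {Q K : ℝ}
    (hK : 0 < K) (hμ : 0 < (ℓ : ℝ) ^ b * Q) (hQ : ∀ t y, ∏ e ∈ E t y, q e = Q)
    (hdisj : ∀ t y y', (∀ j, y j ≠ y' j) → Disjoint (E t y) (E t y'))
    (hover : ∀ t y y', (∃ j, y j = y' j) → ∃ F : Finset I, (∀ e ∈ E t y, e ∈ E t y' → e ∈ F) ∧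
      K ≤ (ℓ : ℝ) ^ (Finset.univ.filter fun j => y j = y' j).card * ∏ e ∈ F, q e)
    (hind : ∀ t t' y y', t ≠ t' → Disjoint (E t y) (E t' y')) :
    bernPr q (fun ω => ∀ t, (presentCount (E t) ω : ℝ) <
      (ℓ : ℝ) ^ b * Q / 2) ≤ (2 ^ (b + 2) / K) ^ T := by
  set μ := (ℓ : ℝ) ^ b * Q
  set f : Fin T → (I → Bool) → ℝ := fun t ω => 4 / μ ^ 2 *
    ((presentCount (E t) ω : ℝ) - μ) ^ 2 with hf
  have hf0 : ∀ t ω, 0 ≤ f t ω := fun t ω => by simp only [hf]; positivity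
  have h1 : 1 * bernPr q (fun ω => ∀ t,
      (presentCount (E t) ω : ℝ) < μ / 2) ≤
      bernEx q fun ω => ∏ t, f t ω := by
    refine hq.mul_bernPr_le (fun ω => Finset.prod_nonneg fun t _ => hf0 t ω) fun ω h => ?_
    rw [← Finset.prod_const_one (ι := Fin T) (s := Finset.univ)]
    refine Finset.prod_le_prod (fun _ _ => zero_le_one) fun t _ => ?_
    have := h t
    simp only [hf]
    rw [div_mul_eq_mul_div, le_div_iff₀ (by positivity)]
    nlinarith
  rw [one_mul] at h1
  refine h1.trans ?_
  rw [bernEx_prod Finset.univ f (fun t => {e | ∃ y, e ∈ E t y})]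
  · have h2 : ∀ t ∈ Finset.univ, bernEx q (f t) ≤ 2 ^ (b + 2) / K := fun t _ => by
      simp only [hf]
      rw [bernEx_const_mul]
      refine (mul_le_mul_of_nonneg_left
        (hq.bernEx_sub_sq_le (E t) hK (hQ t) (hdisj t) (hover t)) (by positivity)).trans ?_
      refine le_of_eq ?_
      have := hμ.ne'
      field_simp
      ring
    refine (Finset.prod_le_prod (fun t _ => hq.bernEx_nonneg (hf0 t)) h2).trans ?_
    rw [Finset.prod_const, Finset.card_univ, Fintype.card_fin]
  · intro t ω ω' h
    simp only [hf]
    unfold presentCount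
    congr 5
    ext y
    simp only [Finset.mem_filter, Finset.mem_univ, true_and]
    exact forall₂_congr fun e he => by rw [h e ⟨y, he⟩]
  · intro t t' htt'
    rw [Set.disjoint_left]
    rintro e ⟨y, hy⟩ ⟨y', hy'⟩
    exact Finset.disjoint_left.1 (hind t t' y y' htt') hy hy'

end SecondMoment

section CopyCounts

variable {k : Fin p → ℕ} {α γ : Fin p → ℝ} {V : Type} [Fintype V]

/-- The image of a family of coloured edges. -/
noncomputable def edgeImage {ι V : Type} (u : ι → V) (F : Finset (Fin p × Finset ι)) :
    Finset (Fin p × Finset V) :=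
  F.image fun e => (e.1, e.2.image u)

lemma mem_edgeImage_of_mem {ι V : Type} {u u' : ι → V} {S : Finset ι}
    (h : ∀ c c', u c = u' c' → c ∈ S) {F F' : Finset (Fin p × Finset ι)}
    (hF : ∀ e ∈ F, e.2 ⊆ S → e ∈ F') {e : Fin p × Finset V} (he : e ∈ edgeImage u F)
    (he' : e ∈ edgeImage u' F) : e ∈ edgeImage u F' := by
  obtain ⟨f, hf, rfl⟩ := Finset.mem_image.1 he
  obtain ⟨f', hf', h'⟩ := Finset.mem_image.1 he'
  refine Finset.mem_image.2 ⟨f, hF f hf fun c hc => ?_, rfl⟩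
  have h1 : u c ∈ f'.2.image u' := by
    have h2 : f'.2.image u' = f.2.image u := (Prod.ext_iff.1 h').2
    rw [h2]
    exact Finset.mem_image_of_mem u hc
  obtain ⟨c', -, hc'⟩ := Finset.mem_image.1 h1
  exact h c c' hc'.symm

lemma prod_edgeImage {ι : Type} {u : ι → V} (hu : Function.Injective u)
    {F : Finset (Fin p × Finset ι)} (hF : ∀ e ∈ F, e.2.card = k e.1) :
    ∏ e ∈ edgeImage u F, edgeProb k α γ V e =
      ∏ e ∈ F, γ e.1 * (Fintype.card V : ℝ) ^ (-α e.1) := by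
  rw [edgeImage, Finset.prod_image]
  · refine Finset.prod_congr rfl fun e he => ?_
    simp only [edgeProb]
    rw [if_pos]
    rw [Finset.card_image_of_injective _ hu, hF e he]
  · rintro ⟨i, C⟩ - ⟨j, D⟩ - h
    simp only [Prod.mk.injEq] at h
    exact Prod.ext h.1 (Finset.image_injective hu h.2)

lemma le_prod_mul_rpow {ι : Type} (hγ : ∀ i, 0 < γ i ∧ γ i ≤ 1) {n : ℝ} (hn : 0 < n)
    {F F' : Finset (Fin p × Finset ι)} (h : F' ⊆ F) :
    (∏ e ∈ F, γ e.1) * n ^ (-∑ e ∈ F', α e.1) ≤ ∏ e ∈ F', γ e.1 * n ^ (-α e.1) := by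
  rw [Finset.prod_mul_distrib, ← Real.rpow_sum_of_pos hn, Finset.sum_neg_distrib,
    ← Finset.prod_sdiff h]
  refine mul_le_mul_of_nonneg_right ?_ (Real.rpow_nonneg hn.le _)
  exact mul_le_of_le_one_left (Finset.prod_nonneg fun e _ => (hγ _).1.le)
    (Finset.prod_le_one (fun e _ => (hγ _).1.le) fun e _ => (hγ _).2)

variable {a b : ℕ} (B : Fin p → Finset (Fin a ⊕ Fin b) → Prop)

/-- The edges of the pattern `B` that involve a new vertex. -/
noncomputable def newEdges : Finset (Fin p × Finset (Fin a ⊕ Fin b)) :=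
  Finset.univ.filter fun e => B e.1 e.2 ∧ ¬ e.2 ⊆ Finset.univ.disjSum ∅

/-- The number of (not necessarily induced) extensions of the tuple `x` to a copy of `B`. -/
noncomputable def extCount (H : Fin p → Finset V → Prop) (x : Fin a → V) : ℕ :=
  (Finset.univ.filter fun y : Fin b → V => Function.Injective (Sum.elim x y) ∧
    ∀ e ∈ newEdges B, H e.1 (e.2.image (Sum.elim x y))).card

variable {B}

lemma predim_disjSum_sub (X : Finset (Fin b)) :
    predim α B (Finset.univ.disjSum X) - predim α B (Finset.univ.disjSum ∅) =
      X.card - ∑ e ∈ (newEdges B).filter fun e => e.2 ⊆ Finset.univ.disjSum X, α e.1 := by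
  rw [predim_sub_eq (Finset.disjSum_mono subset_rfl (Finset.empty_subset X)),
    sum_filter_eq_sum_card (fun i => edgesIn B i (Finset.univ.disjSum X) \
      edgesIn B i (Finset.univ.disjSum ∅))]
  · rw [← Finset.card_image_of_injective X (Sum.inr_injective (α := Fin a))]
    congr! 3 <;> congr!
    ext c
    cases c <;> simp
  · intro i C
    simp only [newEdges, edgesIn, Finset.mem_filter, Finset.mem_univ, true_and,
      Finset.mem_sdiff, Finset.mem_powerset]
    tauto

lemma exists_pos_forall_le {ι : Type*} (S : Finset ι) (f : ι → ℝ) (h : ∀ i ∈ S, 0 < f i) :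
    ∃ ε > 0, ∀ i ∈ S, ε ≤ f i := by
  induction S using Finset.induction_on with
  | empty => exact ⟨1, one_pos, by simp⟩
  | insert i S _ ih =>
    obtain ⟨ε, hε, hS⟩ := ih fun j hj => h j (Finset.mem_insert_of_mem hj)
    refine ⟨min ε (f i), lt_min hε (h i (Finset.mem_insert_self i S)), fun j hj => ?_⟩
    rcases Finset.mem_insert.1 hj with rfl | hj
    · exact min_le_right _ _
    · exact (min_le_left _ _).trans (hS j hj)

lemma exists_pos_le_predim_sub (hirr : IrrHyp α)
    (hB : ∀ X : Finset (Fin b), predim α B (Finset.univ.disjSum ∅) ≤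
      predim α B (Finset.univ.disjSum X)) :
    ∃ ε > 0, ∀ X : Finset (Fin b), X.Nonempty →
      ε ≤ predim α B (Finset.univ.disjSum X) - predim α B (Finset.univ.disjSum ∅) := by
  obtain ⟨ε, hε, h⟩ := exists_pos_forall_le (Finset.univ.filter fun X : Finset (Fin b) =>
    X.Nonempty) (fun X => predim α B (Finset.univ.disjSum X) -
      predim α B (Finset.univ.disjSum ∅)) fun X hX => by
    refine lt_of_le_of_ne (sub_nonneg.2 (hB X)) (Ne.symm ?_)
    rw [predim_sub_eq (Finset.disjSum_mono subset_rfl (Finset.empty_subset X))]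
    refine hirr.sub_sum_ne_zero ?_ _
    obtain ⟨j, hj⟩ := (Finset.mem_filter.1 hX).2
    exact Finset.card_ne_zero.2 ⟨Sum.inr j, by simp [hj]⟩
  exact ⟨ε, hε, fun X hX => h X (by simpa using hX)⟩

set_option maxHeartbeats 1000000 in
/-- The number of extensions of a tuple by a strong pattern is rarely much smaller than its
expectation. -/
lemma bernPr_extCount_lt_le [Nonempty V] (hα : ∀ i, 0 < α i) (hγ : ∀ i, 0 < γ i ∧ γ i ≤ 1)
    (hk : ∀ i C, B i C → C.card = k i) {ε : ℝ}
    (hε : ∀ X : Finset (Fin b), X.Nonempty →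
      ε ≤ predim α B (Finset.univ.disjSum X) - predim α B (Finset.univ.disjSum ∅))
    {T ℓ : ℕ} {L : ℝ} (hL : 1 ≤ L) (hℓ : (Fintype.card V : ℝ) ≤ L * ℓ)
    {x : Fin a → V} (hx : Function.Injective x) {vtx : Fin T × Fin b × Fin ℓ → V}
    (hvtx : Function.Injective vtx) (hvx : ∀ j c, vtx j ≠ x c) :
    bernPr (edgeProb k α γ V) (fun ω => (extCount B (cfgHyp ω) x : ℝ) <
      (∏ e ∈ newEdges B, γ e.1) / (2 * L ^ b) * (Fintype.card V : ℝ) ^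
        (predim α B (Finset.univ.disjSum Finset.univ) - predim α B (Finset.univ.disjSum ∅))) ≤
      (2 ^ (b + 2) * L ^ b / ∏ e ∈ newEdges B, γ e.1) ^ T *
        (Fintype.card V : ℝ) ^ (-(T * ε)) := by
  have hq : IsProb (edgeProb k α γ V) := isProb_edgeProb hα hγ
  have hn1 : (1 : ℝ) ≤ Fintype.card V := by exact_mod_cast Fintype.card_pos
  set n : ℝ := ((Fintype.card V : ℕ) : ℝ) with hn
  have hn0 : 0 < n := by linarith
  have hL0 : 0 < L := by linarith
  set g : ℝ := ∏ e ∈ newEdges B, γ e.1 with hg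
  have hg0 : 0 < g := Finset.prod_pos fun e _ => (hγ _).1
  have hnew : ∀ e ∈ newEdges B, e.2.card = k e.1 := fun e he =>
    hk _ _ (Finset.mem_filter.1 he).2.1
  set u : Fin T → (Fin b → Fin ℓ) → Fin a ⊕ Fin b → V := fun t y =>
    Sum.elim x fun j => vtx (t, j, y j) with hu
  have hinj : ∀ t y, Function.Injective (u t y) := fun t y =>
    hx.sumElim (fun j j' h => by simpa using (congrArg (fun e => e.2.1) (hvtx h)))
      fun c j h => hvx _ _ h.symm
  have hpow : ∀ j ≤ b, n ^ j / L ^ b ≤ (ℓ : ℝ) ^ j := fun j hj => by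
    rw [div_le_iff₀ (by positivity)]
    calc n ^ j ≤ (L * ℓ) ^ j := by gcongr
      _ = ℓ ^ j * L ^ j := by rw [mul_pow, mul_comm]
      _ ≤ ℓ ^ j * L ^ b := by gcongr
  set Q : ℝ := ∏ e ∈ newEdges B, γ e.1 * n ^ (-α e.1) with hQdef
  have hdisj : ∀ t t' y y', (∀ c c', u t y c = u t' y' c' → c ∈ Finset.univ.disjSum ∅) →
      Disjoint (edgeImage (u t y) (newEdges B)) (edgeImage (u t' y') (newEdges B)) := by
    intro t t' y y' h
    refine Finset.disjoint_left.2 fun e he he' => ?_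
    have := mem_edgeImage_of_mem h (F' := ∅) (fun e he h' =>
      ((Finset.mem_filter.1 he).2.2 h').elim) he he'
    simp [edgeImage] at this
  have hμ : g / L ^ b * n ^ (predim α B (Finset.univ.disjSum Finset.univ) -
      predim α B (Finset.univ.disjSum ∅)) ≤ (ℓ : ℝ) ^ b * Q := by
    have h1 := le_prod_mul_rpow (α := α) hγ hn0 (subset_refl (newEdges B))
    rw [predim_disjSum_sub, Finset.card_univ, Fintype.card_fin, sub_eq_add_neg,
      Real.rpow_add hn0, Real.rpow_natCast, Finset.filter_true_of_mem (fun e _ c _ => by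
        cases c <;> simp)]
    calc g / L ^ b * (n ^ b * n ^ (-∑ e ∈ newEdges B, α e.1))
        = n ^ b / L ^ b * (g * n ^ (-∑ e ∈ newEdges B, α e.1)) := by ring
      _ ≤ (ℓ : ℝ) ^ b * Q := mul_le_mul (hpow b le_rfl) h1
          (mul_nonneg hg0.le (Real.rpow_nonneg hn0.le _)) (by positivity)
  have hμ0 : 0 < (ℓ : ℝ) ^ b * Q :=
    lt_of_lt_of_le (mul_pos (by positivity) (Real.rpow_pos_of_pos hn0 _)) hμ
  have hK : 0 < g / L ^ b * n ^ ε := mul_pos (by positivity) (Real.rpow_pos_of_pos hn0 _)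
  have main := hq.bernPr_forall_lt_le (fun t y => edgeImage (u t y) (newEdges B)) hK hμ0
    (fun t y => prod_edgeImage (hinj t y) hnew) ?_ ?_ ?_
  · refine le_trans (hq.bernPr_mono fun ω hω t => ?_) (main.trans (le_of_eq ?_))
    · have h1 : presentCount (fun y => edgeImage (u t y) (newEdges B)) ω ≤
          extCount B (cfgHyp ω) x := by
        refine Finset.card_le_card_of_injOn (fun y j => vtx (t, j, y j)) ?_ ?_
        · intro y hy
          have hy' : ∀ e ∈ edgeImage (u t y) (newEdges B), ω e = true := by
            simpa only [Finset.coe_filter, Finset.mem_univ, true_and, Set.mem_ofPred_eq] using hy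
          simp only [Finset.coe_filter, Finset.mem_univ, true_and, Set.mem_ofPred_eq]
          exact ⟨hinj t y, fun e he => hy' _ (Finset.mem_image_of_mem _ he)⟩
        · intro y _ y' _ h
          funext j
          simpa using hvtx (congrFun h j)
      have h2 : (presentCount (fun y => edgeImage (u t y) (newEdges B)) ω : ℝ) ≤
          extCount B (cfgHyp ω) x := Nat.cast_le.2 h1
      refine lt_of_le_of_lt h2 (lt_of_lt_of_le hω ?_)
      calc g / (2 * L ^ b) * n ^ (predim α B (Finset.univ.disjSum Finset.univ) -
            predim α B (Finset.univ.disjSum ∅))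
          = g / L ^ b * n ^ (predim α B (Finset.univ.disjSum Finset.univ) -
            predim α B (Finset.univ.disjSum ∅)) / 2 := by field_simp
        _ ≤ _ := by linarith
    · rw [mul_comm (T : ℝ) ε, ← neg_mul, Real.rpow_mul hn0.le, Real.rpow_natCast, ← mul_pow,
        Real.rpow_neg hn0.le]
      congr 1
      field_simp
  · intro t y y' h
    refine hdisj t t y y' fun c c' hc => ?_
    rcases c with c | j
    · simp
    rcases c' with c' | j'
    · exact (hvx _ _ hc).elim
    · have := hvtx hc
      simp only [Prod.mk.injEq, true_and] at this
      obtain ⟨rfl, h'⟩ := this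
      exact (h j h').elim
  · intro t y y' hj
    set X := Finset.univ.filter fun j => y j = y' j with hX
    refine ⟨edgeImage (u t y) ((newEdges B).filter fun e => e.2 ⊆ Finset.univ.disjSum X),
      fun e he he' => ?_, ?_⟩
    · refine mem_edgeImage_of_mem (fun c c' hc => ?_) (fun e he h' =>
        Finset.mem_filter.2 ⟨he, h'⟩) he he'
      rcases c with c | j
      · simp
      rcases c' with c' | j'
      · exact (hvx _ _ hc).elim
      · have := hvtx hc
        simp only [Prod.mk.injEq, true_and] at this
        obtain ⟨rfl, h'⟩ := this
        simp [hX, h']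
    rw [prod_edgeImage (hinj t y) fun e he => hnew e (Finset.mem_filter.1 he).1]
    have h2 := le_prod_mul_rpow (α := α) hγ hn0 (Finset.filter_subset
      (fun e => e.2 ⊆ Finset.univ.disjSum X) (newEdges B))
    have hXne : X.Nonempty := by
      obtain ⟨j, hj⟩ := hj
      exact ⟨j, by simp [hX, hj]⟩
    have h3 := hε X hXne
    rw [predim_disjSum_sub] at h3
    have hXb : X.card ≤ b := by simpa using Finset.card_le_univ X
    calc g / L ^ b * n ^ ε
        ≤ g / L ^ b * n ^ ((X.card : ℝ) -
          ∑ e ∈ (newEdges B).filter fun e => e.2 ⊆ Finset.univ.disjSum X, α e.1) := by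
          gcongr
      _ = n ^ X.card / L ^ b * (g * n ^ (-
          ∑ e ∈ (newEdges B).filter fun e => e.2 ⊆ Finset.univ.disjSum X, α e.1)) := by
          rw [sub_eq_add_neg, Real.rpow_add hn0, Real.rpow_natCast]
          ring
      _ ≤ _ := mul_le_mul (hpow _ hXb) h2
          (mul_nonneg hg0.le (Real.rpow_nonneg hn0.le _)) (by positivity)
  · intro t t' y y' htt'
    refine hdisj t t' y y' fun c c' hc => ?_
    rcases c with c | j
    · simp
    rcases c' with c' | j'
    · exact (hvx _ _ hc).elim
    · have := hvtx hc
      simp only [Prod.mk.injEq] at this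
      exact (htt' this.1).elim

end CopyCounts

section LightTuples

variable {k : Fin p → ℕ} {α γ : Fin p → ℝ}

/-- The number of `N`-tuples whose relative predimension over `A` is less than `D`. -/
noncomputable def lightCount {V : Type} [Fintype V] (α : Fin p → ℝ) (H : Fin p → Finset V → Prop)
    (N : ℕ) (D : ℝ) (A : Finset V) : ℕ :=
  (Finset.univ.filter fun z : Fin N → V =>
    predim α H (A ∪ Finset.univ.image z) - predim α H A < D).card

lemma predim_union_biUnion_sub_le {V : Type} {H : Fin p → Finset V → Prop} (hα : ∀ i, 0 < α i)
    {N : ℕ} {A : Finset V} (hA : StrongUpTo α H N A) {ι : Type} (S : Finset ι)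
    (z : ι → Fin N → V) {c : ℝ}
    (hz : ∀ t ∈ S, predim α H (A ∪ Finset.univ.image (z t)) - predim α H A ≤ c) :
    predim α H (A ∪ S.biUnion fun t => Finset.univ.image (z t)) - predim α H A ≤ S.card * c := by
  induction S using Finset.induction_on with
  | empty => simp
  | insert t S ht ih =>
    have h1 := ih fun t h => hz t (Finset.mem_insert_of_mem h)
    have h2 := hz t (Finset.mem_insert_self t S)
    have h3 := predim_union_add_inter_le (H := H) (fun i => (hα i).le)
      (A ∪ S.biUnion fun t => Finset.univ.image (z t)) (A ∪ Finset.univ.image (z t))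
    have h4 := hA ((A ∪ S.biUnion fun t => Finset.univ.image (z t)) ∩
      (A ∪ Finset.univ.image (z t)))
      (Finset.subset_inter Finset.subset_union_left Finset.subset_union_left) (by
        refine (Finset.card_le_card (t := Finset.univ.image (z t)) ?_).trans
          (Finset.card_image_le.trans (by simp))
        intro v hv
        simp only [Finset.mem_sdiff, Finset.mem_inter, Finset.mem_union] at hv
        tauto)
    have h5 : (A ∪ S.biUnion fun t => Finset.univ.image (z t)) ∪ (A ∪ Finset.univ.image (z t)) =
        A ∪ (insert t S).biUnion fun t => Finset.univ.image (z t) := by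
      rw [Finset.biUnion_insert]
      ext v
      simp only [Finset.mem_union]
      tauto
    rw [h5] at h3
    rw [Finset.card_insert_of_notMem ht]
    push_cast
    linarith

/-- Over a strong set there are rarely many tuples of small relative predimension. -/
lemma bernPr_le_lightCount {V : Type} [Fintype V] [Nonempty V] (hα : ∀ i, 0 < α i)
    (hγ : ∀ i, 0 < γ i ∧ γ i ≤ 1) {N : ℕ} {D ε : ℝ}
    (hε : ∀ (V : Type) (H : Fin p → Finset V → Prop) (A X : Finset V), A ⊆ X →
      (X \ A).card ≤ N → predim α H X - predim α H A < D →
        predim α H X - predim α H A ≤ D - ε)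
    (T : ℕ) {g : ℝ} (hg : 0 < g) (A : Finset V) :
    bernPr (edgeProb k α γ V) (fun ω => StrongUpTo α (cfgHyp ω) N A ∧
      g * (Fintype.card V : ℝ) ^ D ≤ lightCount α (cfgHyp ω) N D A) ≤
      2 ^ (p * 2 ^ (A.card + T * N)) * (A.card + (T * N : ℕ) + 1) ^ (T * N) / g ^ T *
        (Fintype.card V : ℝ) ^ (-(T * ε)) := by
  have hq : IsProb (edgeProb k α γ V) := isProb_edgeProb hα hγ
  have hn0 : (0 : ℝ) < Fintype.card V := by exact_mod_cast Fintype.card_pos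
  have hsum := sum_bernPr_predim_sub_le (k := k) hα hγ A (T * N) (T * (D - ε))
  set n : ℝ := ((Fintype.card V : ℕ) : ℝ) with hn
  have hmarkov := hq.mul_bernPr_le (c := (g * n ^ D) ^ T)
    (P := fun ω => StrongUpTo α (cfgHyp ω) N A ∧ g * n ^ D ≤ lightCount α (cfgHyp ω) N D A)
    (f := fun ω => ∑ z : Fin (T * N) → V, if predim α (cfgHyp ω) (A ∪ Finset.univ.image z) -
      predim α (cfgHyp ω) A ≤ T * (D - ε) then (1 : ℝ) else 0)
    (fun ω => Finset.sum_nonneg fun z _ => by split_ifs <;> norm_num) (by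
      rintro ω ⟨hA, hl⟩
      refine (pow_le_pow_left₀ (by positivity) hl T).trans ?_
      rw [Finset.sum_boole, ← Nat.cast_pow, Nat.cast_le]
      set S := Finset.univ.filter fun z : Fin N → V =>
        predim α (cfgHyp ω) (A ∪ Finset.univ.image z) - predim α (cfgHyp ω) A < D with hS
      have h1 : lightCount α (cfgHyp ω) N D A ^ T =
          (Fintype.piFinset fun _ : Fin T => S).card := by
        rw [Fintype.card_piFinset_const, lightCount]
      rw [h1]
      refine Finset.card_le_card_of_injOn
        (fun z j => z (finProdFinEquiv.symm j).1 (finProdFinEquiv.symm j).2) ?_ ?_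
      · intro z hz
        have hz' : ∀ t, z t ∈ S := Fintype.mem_piFinset.1 hz
        have h2 := predim_union_biUnion_sub_le hα hA Finset.univ z (c := D - ε) fun t _ =>
          hε V (cfgHyp ω) A _ Finset.subset_union_left (by
            rw [Finset.union_sdiff_left]
            exact (Finset.card_le_card Finset.sdiff_subset).trans
              (Finset.card_image_le.trans (by simp))) (Finset.mem_filter.1 (hz' t)).2
        have h3 : (Finset.univ.biUnion fun t => Finset.univ.image (z t)) =
            Finset.univ.image fun j : Fin (T * N) =>
              z (finProdFinEquiv.symm j).1 (finProdFinEquiv.symm j).2 := by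
          ext v
          simp only [Finset.mem_biUnion, Finset.mem_image, Finset.mem_univ, true_and]
          constructor
          · rintro ⟨t, j, h⟩
            exact ⟨finProdFinEquiv (t, j), by simpa using h⟩
          · rintro ⟨j, h⟩
            exact ⟨_, _, h⟩
        rw [h3, Finset.card_univ, Fintype.card_fin] at h2
        simpa only [Finset.coe_filter, Finset.mem_univ, true_and, Set.mem_ofPred_eq] using h2
      · intro z _ z' _ h
        funext t j
        simpa using congrFun h (finProdFinEquiv (t, j)))
  rw [bernEx_sum] at hmarkov
  have h := hmarkov.trans hsum
  have hgD : 0 < (g * n ^ D) ^ T := by positivity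
  rw [mul_comm, ← le_div_iff₀ hgD] at h
  refine h.trans (le_of_eq ?_)
  have h6 : n ^ ((T : ℝ) * (D - ε)) = (n ^ D) ^ T * n ^ (-((T : ℝ) * ε)) := by
    rw [← Real.rpow_natCast, ← Real.rpow_mul hn0.le, ← Real.rpow_add hn0]
    ring_nf
  rw [h6, mul_pow]
  have : (n ^ D) ^ T ≠ 0 := by positivity
  field_simp

end LightTuples

section ExtensionFromCounts

variable {k : Fin p → ℕ} {α γ : Fin p → ℝ}

/-- A hypergraph containing another one of at least the same predimension is equal to it. -/
lemma iff_of_predim_le {ι : Type} [Fintype ι] (hα : ∀ i, 0 < α i) {H B : Fin p → Finset ι → Prop}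
    (hBH : ∀ i C, B i C → H i C) (h : predim α B Finset.univ ≤ predim α H Finset.univ)
    (i : Fin p) (C : Finset ι) : H i C ↔ B i C := by
  have hsub : ∀ i, edgesIn B i Finset.univ ⊆ edgesIn H i Finset.univ := fun i C hC => by
    simp only [edgesIn, Finset.mem_filter] at hC ⊢
    exact ⟨hC.1, hBH i C hC.2⟩
  refine ⟨fun hC => ?_, hBH i C⟩
  by_contra hcon
  have hlt : ∑ i, α i * ((edgesIn B i Finset.univ).card : ℝ) <
      ∑ i, α i * ((edgesIn H i Finset.univ).card : ℝ) := by
    refine Finset.sum_lt_sum (fun j _ => mul_le_mul_of_nonneg_left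
      (Nat.cast_le.2 (Finset.card_le_card (hsub j))) (hα j).le) ⟨i, Finset.mem_univ i,
        mul_lt_mul_of_pos_left (Nat.cast_lt.2 (Finset.card_lt_card ?_)) (hα i)⟩
    refine (Finset.ssubset_iff_of_subset (hsub i)).2 ⟨C, ?_, ?_⟩
    · simp [edgesIn, hC]
    · simp [edgesIn, hcon]
  simp only [predim] at h
  linarith

variable {V : Type} [Fintype V] {a b m : ℕ} {B : Fin p → Finset (Fin a ⊕ Fin b) → Prop}

lemma exists_extension_of_lightCount_lt (hα : ∀ i, 0 < α i) {H : Fin p → Finset V → Prop}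
    {x : Fin a → V}
    (hxB : ∀ i (C : Finset (Fin a)), H i (C.image x) ↔ B i (C.image Sum.inl))
    (hlt : lightCount α H (b + m) (predim α B (Finset.univ.disjSum Finset.univ) -
      predim α B (Finset.univ.disjSum ∅)) (Finset.univ.image x) < extCount B H x) :
    ∃ y : Fin b → V, Function.Injective (Sum.elim x y) ∧
      (∀ i C, H i (C.image (Sum.elim x y)) ↔ B i C) ∧
      StrongUpTo α H m (Finset.univ.image (Sum.elim x y)) := by
  obtain ⟨y, hy, hye, hz⟩ : ∃ y : Fin b → V, Function.Injective (Sum.elim x y) ∧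
      (∀ e ∈ newEdges B, H e.1 (e.2.image (Sum.elim x y))) ∧ ∀ z : Fin m → V,
        predim α B (Finset.univ.disjSum Finset.univ) - predim α B (Finset.univ.disjSum ∅) ≤
          predim α H (Finset.univ.image x ∪ Finset.univ.image (Fin.append y z)) -
            predim α H (Finset.univ.image x) := by
    by_contra! hcon
    refine absurd hlt (not_lt.2 ?_)
    refine Finset.card_le_card_of_surjOn (fun w j => w (Fin.castAdd m j)) fun y hy => ?_
    simp only [Finset.coe_filter, Finset.mem_univ, true_and, Set.mem_ofPred_eq] at hy
    obtain ⟨z, hz⟩ := hcon y hy.1 hy.2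
    refine ⟨Fin.append y z, ?_, ?_⟩
    · simpa only [Finset.coe_filter, Finset.mem_univ, true_and, Set.mem_ofPred_eq] using hz
    · funext j
      simp
  set u := Sum.elim x y with hu
  set H' : Fin p → Finset (Fin a ⊕ Fin b) → Prop := fun i C => H i (C.image u) with hH'
  have hpre : ∀ C, predim α H (C.image u) = predim α H' C := fun C =>
    predim_image hy.injOn fun _ _ _ => Iff.rfl
  have hinl : (Finset.univ : Finset (Fin a)).disjSum (∅ : Finset (Fin b)) =
      Finset.univ.image Sum.inl := by
    ext c
    cases c <;> simp
  have huniv : (Finset.univ : Finset (Fin a)).disjSum (Finset.univ : Finset (Fin b)) =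
      Finset.univ := by
    ext c
    cases c <;> simp
  have hbase : ∀ i, ∀ C ⊆ (Finset.univ : Finset (Fin a)).disjSum (∅ : Finset (Fin b)),
      (H' i C ↔ B i C) := fun i C hC => by
    rw [hinl] at hC
    obtain ⟨C₀, -, rfl⟩ := Finset.subset_image_iff.1 hC
    rw [← hxB, hH']
    simp only [Finset.image_image, hu, Sum.elim_comp_inl]
  have hBH : ∀ i C, B i C → H' i C := fun i C hC => by
    by_cases h : C ⊆ Finset.univ.disjSum ∅
    · exact (hbase i C h).2 hC
    · exact hye (i, C) (Finset.mem_filter.2 ⟨Finset.mem_univ _, hC, h⟩)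
  have hpbase : predim α H' (Finset.univ.disjSum ∅) = predim α B (Finset.univ.disjSum ∅) := by
    have h : ∀ i, edgesIn H' i (Finset.univ.disjSum ∅) = edgesIn B i (Finset.univ.disjSum ∅) :=
      fun i => Finset.filter_congr fun C hC => hbase i C (Finset.mem_powerset.1 hC)
    simp only [predim, h]
  have hximg : Finset.univ.image x = (Finset.univ.disjSum ∅).image u := by
    rw [hinl, Finset.image_image, hu, Sum.elim_comp_inl]
  have hunion : ∀ z : Fin m → V, Finset.univ.image x ∪ Finset.univ.image (Fin.append y z) =
      Finset.univ.image u ∪ Finset.univ.image z := fun z => by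
    ext v
    simp only [Finset.mem_union, Finset.mem_image, Finset.mem_univ, true_and, hu, Sum.exists,
      Sum.elim_inl, Sum.elim_inr, or_assoc]
    refine or_congr_right ⟨?_, ?_⟩
    · rintro ⟨j, rfl⟩
      refine Fin.addCases (fun j => Or.inl ⟨j, ?_⟩) (fun j => Or.inr ⟨j, ?_⟩) j <;> simp
    · rintro (⟨j, rfl⟩ | ⟨j, rfl⟩)
      · exact ⟨Fin.castAdd m j, by simp⟩
      · exact ⟨Fin.natAdd b j, by simp⟩
  have hz' : ∀ z : Fin m → V, predim α B Finset.univ ≤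
      predim α H (Finset.univ.image u ∪ Finset.univ.image z) := fun z => by
    have := hz z
    rw [hunion, hximg, hpre, hpbase, huniv] at this
    linarith
  have hle : predim α B Finset.univ ≤ predim α H' Finset.univ := by
    rcases Nat.eq_zero_or_pos b with rfl | hb
    · rw [← huniv, show (Finset.univ : Finset (Fin 0)) = ∅ from Finset.univ_eq_empty, hpbase]
    · have h1 := hz' fun _ => y ⟨0, hb⟩
      rw [Finset.union_eq_left.2, hpre] at h1
      · exact h1
      · intro v hv
        obtain ⟨-, -, rfl⟩ := Finset.mem_image.1 hv
        exact Finset.mem_image.2 ⟨Sum.inr ⟨0, hb⟩, Finset.mem_univ _, rfl⟩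
  have hiff := iff_of_predim_le hα hBH hle
  refine ⟨y, hy, hiff, strongUpTo_iff_tuple.2 fun z => ?_⟩
  have hHB : H' = B := by
    funext i C
    exact propext (hiff i C)
  rw [hpre, hHB]
  exact hz' z

end ExtensionFromCounts

section ExtensionProbability

variable {k : Fin p → ℕ} {α γ : Fin p → ℝ} {a b : ℕ} {B : Fin p → Finset (Fin a ⊕ Fin b) → Prop}

lemma exists_disjoint_blocks {V : Type} [Fintype V] (T : ℕ)
    (hV : max (2 * a) (2 * (T * b + 1)) ≤ Fintype.card V) (x : Fin a → V) :
    ∃ (ℓ : ℕ) (vtx : Fin T × Fin b × Fin ℓ → V), Fintype.card V ≤ 4 * (T * b + 1) * ℓ ∧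
      Function.Injective vtx ∧ ∀ j c, vtx j ≠ x c := by
  obtain ⟨h1, h2⟩ := max_le_iff.1 hV
  set n := Fintype.card V with hn
  set d := 2 * (T * b + 1) with hd
  have hd0 : 0 < d := by omega
  set ℓ := n / d with hℓ
  have h3 : 1 ≤ ℓ := (Nat.one_le_div_iff hd0).2 h2
  have h4 : d * ℓ ≤ n := Nat.mul_div_le n d
  have h5 : n < d * (ℓ + 1) := Nat.lt_mul_div_succ n hd0
  have h6 : T * b * ℓ + a ≤ n := by nlinarith
  have hcard : Fintype.card (Fin T × Fin b × Fin ℓ) ≤ Fintype.card {v : V // v ∉ Set.range x} := by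
    have h7 : Fintype.card (Set.range x) ≤ a := by
      simpa using Fintype.card_range_le x
    have h8 := Fintype.card_subtype_compl (fun v : V => v ∈ Set.range x)
    have h9 : Fintype.card {v : V // v ∈ Set.range x} = Fintype.card (Set.range x) := rfl
    simp only [Fintype.card_prod, Fintype.card_fin]
    rw [← mul_assoc]
    omega
  obtain ⟨f⟩ := Function.Embedding.nonempty_of_card_le hcard
  refine ⟨ℓ, fun j => f j, by nlinarith, fun i j h => f.injective (Subtype.ext h), fun j c h => ?_⟩
  exact (f j).2 ⟨c, h.symm⟩

set_option maxHeartbeats 1000000 in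
/-- The extension property for a strong pattern fails with small probability. -/
lemma exists_bernPr_not_extensionProp_le (hα : ∀ i, 0 < α i) (hγ : ∀ i, 0 < γ i ∧ γ i ≤ 1)
    (hirr : IrrHyp α) (hk : ∀ i C, B i C → C.card = k i)
    (hB : ∀ X : Finset (Fin b), predim α B (Finset.univ.disjSum ∅) ≤
      predim α B (Finset.univ.disjSum X)) (m : ℕ) :
    ∃ (K : ℝ) (n₀ : ℕ), ∀ (V : Type) [Fintype V] [Nonempty V], n₀ ≤ Fintype.card V →
      bernPr (edgeProb k α γ V) (fun ω => ¬ ExtensionProp α (cfgHyp ω) m B) ≤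
        K * (Fintype.card V : ℝ)⁻¹ := by
  obtain ⟨ε₁, hε₁, h1⟩ := exists_pos_le_predim_sub hirr hB
  set D := predim α B (Finset.univ.disjSum Finset.univ) - predim α B (Finset.univ.disjSum ∅)
    with hD
  obtain ⟨ε₂, hε₂, h2⟩ := exists_predim_gap hα (b + m) D
  obtain ⟨T, hT⟩ := exists_nat_ge ((a + 1 : ℝ) / min ε₁ ε₂)
  rw [div_le_iff₀ (lt_min hε₁ hε₂)] at hT
  have hT₁ : (a + 1 : ℝ) ≤ T * ε₁ := hT.trans (by gcongr; exact min_le_left _ _)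
  have hT₂ : (a + 1 : ℝ) ≤ T * ε₂ := hT.trans (by gcongr; exact min_le_right _ _)
  set L : ℝ := ((4 * (T * b + 1) : ℕ) : ℝ) with hL
  have hL1 : 1 ≤ L := by
    rw [hL]
    exact_mod_cast (by omega : 1 ≤ 4 * (T * b + 1))
  have hg₀ : 0 < ∏ e ∈ newEdges B, γ e.1 := Finset.prod_pos fun e _ => (hγ _).1
  set g : ℝ := (∏ e ∈ newEdges B, γ e.1) / (2 * L ^ b) with hg
  have hg0 : 0 < g := by positivity
  set K₁ : ℝ := (2 ^ (b + 2) * L ^ b / ∏ e ∈ newEdges B, γ e.1) ^ T with hK₁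
  set K₂ : ℝ := 2 ^ (p * 2 ^ (a + T * (b + m))) * (a + (T * (b + m) : ℕ) + 1) ^ (T * (b + m)) /
    g ^ T with hK₂
  refine ⟨K₁ + K₂, max (2 * a) (2 * (T * b + 1)), fun V _ _ hV => ?_⟩
  have hq : IsProb (edgeProb k α γ V) := isProb_edgeProb hα hγ
  have hn1 : (1 : ℝ) ≤ Fintype.card V := by exact_mod_cast Fintype.card_pos
  have hcardV : (Finset.univ.filter fun x : Fin a → V => Function.Injective x).card ≤
      Fintype.card V ^ a := by
    simpa using Finset.card_filter_le (Finset.univ : Finset (Fin a → V)) Function.Injective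
  have hbad : ∀ ω : Fin p × Finset V → Bool, ¬ ExtensionProp α (cfgHyp ω) m B →
      ∃ x ∈ Finset.univ.filter (fun x : Fin a → V => Function.Injective x),
        ((extCount B (cfgHyp ω) x : ℝ) < g * (Fintype.card V : ℝ) ^ D) ∨
        (StrongUpTo α (cfgHyp ω) (b + m) (Finset.univ.image x) ∧
          g * (Fintype.card V : ℝ) ^ D ≤
            lightCount α (cfgHyp ω) (b + m) D (Finset.univ.image x)) := by
    intro ω hω
    by_contra! hcon
    refine hω fun x hx hxB hs => ?_
    obtain ⟨h3, h4⟩ := hcon x (Finset.mem_filter.2 ⟨Finset.mem_univ _, hx⟩)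
    exact exists_extension_of_lightCount_lt hα hxB
      (Nat.cast_lt.1 (lt_of_lt_of_le (h4 hs) h3))
  refine (hq.bernPr_mono hbad).trans ((hq.bernPr_exists_le _ _).trans ?_)
  set n : ℝ := ((Fintype.card V : ℕ) : ℝ) with hn
  have hn0 : 0 < n := by linarith
  have hexp : ∀ {c : ℝ}, (a + 1 : ℝ) ≤ c → n ^ (-c) ≤ (n ^ (a + 1))⁻¹ := fun {c} hc => by
    rw [← Real.rpow_natCast, ← Real.rpow_neg hn0.le]
    refine Real.rpow_le_rpow_of_exponent_le hn1 ?_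
    push_cast
    linarith
  have hK₁0 : 0 ≤ K₁ := by positivity
  have hK₂0 : 0 ≤ K₂ := by positivity
  refine (Finset.sum_le_card_nsmul _ _ ((K₁ + K₂) * (n ^ (a + 1))⁻¹) fun x hx => ?_).trans ?_
  · have hxi : Function.Injective x := (Finset.mem_filter.1 hx).2
    refine (hq.bernPr_or_le _ _).trans ?_
    rw [add_mul]
    refine add_le_add ?_ ?_
    · obtain ⟨ℓ, vtx, hℓ, hvtx, hvx⟩ := exists_disjoint_blocks (b := b) T hV x
      refine (bernPr_extCount_lt_le hα hγ hk h1 hL1 (ℓ := ℓ) (by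
        rw [hL]; exact_mod_cast hℓ) hxi hvtx hvx).trans ?_
      exact mul_le_mul_of_nonneg_left (hexp hT₁) hK₁0
    · have h3 := bernPr_le_lightCount (k := k) hα hγ h2 T hg0 (Finset.univ.image x)
      rw [Finset.card_image_of_injective _ hxi, Finset.card_univ, Fintype.card_fin] at h3
      exact h3.trans (mul_le_mul_of_nonneg_left (hexp hT₂) hK₂0)
  · rw [nsmul_eq_mul]
    have h3 : ((Finset.univ.filter fun x : Fin a → V => Function.Injective x).card : ℝ) ≤
        n ^ a := by
      rw [hn]
      exact_mod_cast hcardV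
    refine (mul_le_mul_of_nonneg_right h3 (by positivity)).trans (le_of_eq ?_)
    rw [pow_succ]
    field_simp

end ExtensionProbability

section AlmostSureTheory

variable {k : Fin p → ℕ} {α γ : Fin p → ℝ}

lemma mem_Talpha (hα : ∀ i, 0 < α i) (hγ : ∀ i, 0 < γ i ∧ γ i ≤ 1) {σ : (Lang p k).Sentence}
    (Q : ∀ n, (Fin p × Finset (Fin n) → Bool) → Prop)
    (hQ : ∀ n, 0 < n → ∀ E ∈ validE k n,
      (letI := structOf k n E; Fin n ⊨ σ) ↔ Q n fun e => E e.1 e.2) {f : ℕ → ℝ}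
    (hf : ∀ᶠ n in atTop, 0 < n → bernPr (edgeProb k α γ (Fin n)) (fun ω => ¬ Q n ω) ≤ f n)
    (hlim : Tendsto f atTop (𝓝 0)) : σ ∈ Talpha k α γ := by
  have h1 : Tendsto (fun n => 1 - f n) atTop (𝓝 1) := by simpa using tendsto_const_nhds.sub hlim
  refine tendsto_of_tendsto_of_tendsto_of_le_of_le' h1 tendsto_const_nhds ?_ ?_
  · filter_upwards [hf, eventually_gt_atTop 0] with n hn h0
    rw [Pn, Pev_eq_bernPr n _ (Q n) (hQ n h0)]
    have := hn h0
    rw [bernPr_not] at this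
    linarith
  · filter_upwards [eventually_gt_atTop 0] with n h0
    rw [Pn, Pev_eq_bernPr n _ (Q n) (hQ n h0)]
    have : Nonempty (Fin n) := ⟨⟨0, h0⟩⟩
    have := (isProb_edgeProb (k := k) (V := Fin n) hα hγ).bernPr_nonneg fun ω => ¬ Q n ω
    rw [bernPr_not] at this
    linarith

lemma exists_mem_Talpha_symmIrr (hα : ∀ i, 0 < α i) (hγ : ∀ i, 0 < γ i ∧ γ i ≤ 1) (i : Fin p) :
    ∃ σ ∈ Talpha k α γ, ∀ (M : Type) [Nonempty M] [(Lang p k).Structure M],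
      M ⊨ σ ↔ ∀ x : Fin (k i) → M,
        Language.Structure.RelMap (L := Lang p k) (⟨i, rfl⟩ : (Lang p k).Relations (k i)) x →
        Function.Injective x ∧ ∀ σ : Equiv.Perm (Fin (k i)),
          Language.Structure.RelMap (L := Lang p k) (⟨i, rfl⟩ : (Lang p k).Relations (k i))
            (x ∘ σ) := by
  obtain ⟨σ, hσ⟩ := exists_sentence_symmIrr k i
  refine ⟨σ, mem_Talpha hα hγ (fun n _ => True) (fun n h0 E _ => ?_) (f := fun _ => 0)
    (Eventually.of_forall fun n _ => ?_) tendsto_const_nhds, hσ⟩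
  · have : Nonempty (Fin n) := ⟨⟨0, h0⟩⟩
    let _ := structOf k n E
    rw [hσ (Fin n), iff_true]
    rintro x ⟨hx, hE⟩
    refine ⟨hx, fun τ => ⟨hx.comp τ.injective, ?_⟩⟩
    rw [← hE]
    congr 1
    ext v
    simp only [Finset.mem_image, Finset.mem_univ, true_and, Function.comp_apply]
    exact ⟨fun ⟨j, h⟩ => ⟨τ j, h⟩, fun ⟨j, h⟩ => ⟨τ.symm j, by simpa using h⟩⟩
  · simp [bernPr, bernEx]

lemma tendsto_natCast_rpow_neg {c : ℝ} (hc : 0 < c) :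
    Tendsto (fun n : ℕ => (n : ℝ) ^ (-c)) atTop (𝓝 0) :=
  (tendsto_rpow_neg_atTop hc).comp tendsto_natCast_atTop_atTop

lemma exists_mem_Talpha_nonneg (hα : ∀ i, 0 < α i) (hγ : ∀ i, 0 < γ i ∧ γ i ≤ 1) (s : ℕ) :
    ∃ σ ∈ Talpha k α γ, ∀ (M : Type) [Nonempty M] [(Lang p k).Structure M],
      M ⊨ σ ↔ ∀ z : Fin s → M, 0 ≤ predim α (hyp k M) (Finset.univ.image z) := by
  obtain ⟨σ, hσ⟩ := exists_sentence_nonneg k α s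
  obtain ⟨ε, hε, K, hK⟩ := exists_bernPr_not_nonneg_le (k := k) hα hγ s
  refine ⟨σ, mem_Talpha hα hγ (fun n ω => NonnegUpTo α (cfgHyp ω) s) (fun n h0 E hE => ?_)
    (f := fun n => ∑ i, (n : ℝ) ^ (-α i) + K * (n : ℝ) ^ (-ε))
    (Eventually.of_forall fun n h0 => ?_) ?_, hσ⟩
  · have : Nonempty (Fin n) := ⟨⟨0, h0⟩⟩
    let _ := structOf k n E
    rw [hσ (Fin n), ← hyp_structOf n E hE]
    rfl
  · have : Nonempty (Fin n) := ⟨⟨0, h0⟩⟩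
    simpa using hK (Fin n)
  · have h1 : Tendsto (fun n : ℕ => ∑ i, (n : ℝ) ^ (-α i)) atTop (𝓝 (∑ _i : Fin p, 0)) :=
      tendsto_finsetSum _ fun i _ => tendsto_natCast_rpow_neg (hα i)
    simpa using h1.add ((tendsto_natCast_rpow_neg hε).const_mul K)

lemma exists_mem_Talpha_extension (hα : ∀ i, 0 < α i) (hγ : ∀ i, 0 < γ i ∧ γ i ≤ 1)
    (hirr : IrrHyp α) {a b : ℕ} {B : Fin p → Finset (Fin a ⊕ Fin b) → Prop}
    (hk : ∀ i C, B i C → C.card = k i)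
    (hB : ∀ X : Finset (Fin b), predim α B (Finset.univ.disjSum ∅) ≤
      predim α B (Finset.univ.disjSum X)) (m : ℕ) :
    ∃ σ ∈ Talpha k α γ, ∀ (M : Type) [Nonempty M] [(Lang p k).Structure M],
      M ⊨ σ ↔ ExtensionProp α (hyp k M) m B := by
  obtain ⟨σ, hσ⟩ := exists_sentence_extension k α m B
  obtain ⟨K, n₀, hK⟩ := exists_bernPr_not_extensionProp_le hα hγ hirr hk hB m
  refine ⟨σ, mem_Talpha hα hγ (fun n ω => ExtensionProp α (cfgHyp ω) m B)
    (fun n h0 E hE => ?_) (f := fun n => K * (n : ℝ)⁻¹) ?_ ?_, hσ⟩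
  · have : Nonempty (Fin n) := ⟨⟨0, h0⟩⟩
    let _ := structOf k n E
    rw [hσ (Fin n), ← hyp_structOf n E hE]
  · filter_upwards [eventually_ge_atTop n₀] with n hn h0
    have : Nonempty (Fin n) := ⟨⟨0, h0⟩⟩
    simpa using hK (Fin n) (by simpa using hn)
  · simpa using (tendsto_inv_atTop_nhds_zero_nat (𝕜 := ℝ)).const_mul K

/-- Models of the almost sure theory satisfy the axioms of nonnegative predimension and
extension of strong patterns. -/
lemma alphaModel_of_model (hα : ∀ i, 0 < α i) (hγ : ∀ i, 0 < γ i ∧ γ i ≤ 1) (hirr : IrrHyp α)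
    {M : Type} [Nonempty M] [(Lang p k).Structure M] (hM : M ⊨ Talpha k α γ) :
    AlphaModel k α M where
  symmIrr := by
    have h : ∀ i (x : Fin (k i) → M),
        Language.Structure.RelMap (L := Lang p k) (⟨i, rfl⟩ : (Lang p k).Relations (k i)) x →
        Function.Injective x ∧ ∀ σ : Equiv.Perm (Fin (k i)),
          Language.Structure.RelMap (L := Lang p k) (⟨i, rfl⟩ : (Lang p k).Relations (k i))
            (x ∘ σ) := fun i => by
      obtain ⟨σ, hσ, h⟩ := exists_mem_Talpha_symmIrr hα hγ i
      exact (h M).1 (hM.realize_of_mem σ hσ)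
    refine ⟨?_, ?_⟩
    · rintro n ⟨i, rfl⟩ v hv
      exact (h i v hv).1
    · rintro n ⟨i, rfl⟩ v τ hv
      exact (h i v hv).2 τ
  nonneg A := by
    obtain ⟨e, -, he⟩ := exists_enum A
    obtain ⟨σ, hσ, h⟩ := exists_mem_Talpha_nonneg (k := k) hα hγ A.card
    have := (h M).1 (hM.realize_of_mem σ hσ) e
    rwa [he] at this
  exists_extension a b m H hk hB := by
    obtain ⟨σ, hσ, h⟩ := exists_mem_Talpha_extension hα hγ hirr hk hB m
    exact (h M).1 (hM.realize_of_mem σ hσ)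

end AlmostSureTheory

-- STATEMENT 2
theorem Talpha_nearly_model_complete (k : Fin p → ℕ) (α γ : Fin p → ℝ)
    (hα : ∀ i, 0 < α i ∧ α i ≤ 1) (hγ : ∀ i, 0 < γ i ∧ γ i ≤ 1)
    (hirr : IrrHyp α) (r : ℕ) (φ : (Lang p k).Formula (Fin r)) :
    ∃ ψ : (Lang p k).Formula (Fin r), IsBoolCombExistential k ψ ∧
      Talpha k α γ ⊨ᵇ (φ.iff ψ) := by
  obtain ⟨ψ, hψ, h⟩ := exists_isBoolCombExistential (k := k) (fun i => (hα i).1) φ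
  refine ⟨ψ, hψ, Language.Theory.models_formula_iff.2 fun M v => ?_⟩
  exact Language.Formula.realize_iff.2
    (h M (alphaModel_of_model (fun i => (hα i).1) hγ hirr M.is_model) v)
end

section
/- Assume the Irrationality Hypothesis. Then the almost sure theory T^α has the finite model property: every L⁺-sentence σ entailed by T^α has a finite model; indeed, for every such σ there are arbitrarily large finite models of σ. -/
open FirstOrder Filter Topology
open scoped Classical

variable {p : ℕ}

/-- The valid configurations form a product of sets of Boolean choices. -/
theorem validE_eq_piFinset (k : Fin p → ℕ) (n : ℕ) :
    validE k n = Fintype.piFinset (fun i : Fin p => Fintype.piFinset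
      (fun C : Finset (Fin n) => if C.card = k i then Finset.univ else {false})) := by
  ext E
  simp only [validE, Finset.mem_filter, Finset.mem_univ, true_and, Fintype.mem_piFinset]
  refine forall_congr' fun i => forall_congr' fun C => ?_
  by_cases h : C.card = k i <;> simp [h]

/-- The weights of the valid configurations add up to `1`. -/
theorem sum_weight_validE (k : Fin p → ℕ) (α γ : Fin p → ℝ) (n : ℕ) :
    ∑ E ∈ validE k n, weight k α γ n E = 1 := by
  simp only [validE_eq_piFinset, weight, Finset.prod_filter]
  rw [← Finset.prod_univ_sum (f := fun (i : Fin p) (E : Finset (Fin n) → Bool) =>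
    ∏ C, if C.card = k i then
      (if E C = true then γ i * (n : ℝ) ^ (-(α i)) else 1 - γ i * (n : ℝ) ^ (-(α i))) else 1)]
  refine Finset.prod_eq_one fun i _ => ?_
  rw [← Finset.prod_univ_sum (f := fun (C : Finset (Fin n)) (b : Bool) =>
    if C.card = k i then
      (if b = true then γ i * (n : ℝ) ^ (-(α i)) else 1 - γ i * (n : ℝ) ^ (-(α i))) else 1)]
  refine Finset.prod_eq_one fun C _ => ?_
  by_cases h : C.card = k i <;> simp [h]

theorem weight_nonneg (k : Fin p → ℕ) {α γ : Fin p → ℝ} (hα : ∀ i, 0 ≤ α i)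
    (hγ : ∀ i, 0 ≤ γ i ∧ γ i ≤ 1) {n : ℕ} (hn : 1 ≤ n) (E : Config p n) :
    0 ≤ weight k α γ n E := by
  refine Finset.prod_nonneg fun i _ => Finset.prod_nonneg fun C _ => ?_
  have h0 : 0 ≤ (n : ℝ) ^ (-(α i)) := by positivity
  have h1 : (n : ℝ) ^ (-(α i)) ≤ 1 :=
    Real.rpow_le_one_of_one_le_of_nonpos (by exact_mod_cast hn) (neg_nonpos.2 (hα i))
  split_ifs
  · exact mul_nonneg (hγ i).1 h0
  · exact sub_nonneg.2 (mul_le_one₀ (hγ i).2 h0 h1)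

theorem one_sub_Pev (k : Fin p → ℕ) (α γ : Fin p → ℝ) (n : ℕ) (Q : Config p n → Prop) :
    1 - Pev k α γ n Q = Pev k α γ n (fun E => ¬ Q E) := by
  rw [← sum_weight_validE k α γ n, Pev, Pev, ← Finset.sum_sub_distrib]
  refine Finset.sum_congr rfl fun E _ => ?_
  by_cases h : Q E <;> simp [h]

/-- Union bound: finitely many events whose complements have total probability less than `1`
occur simultaneously for some configuration. -/
theorem exists_forall_of_sum_one_sub_Pev_lt_one {ι : Type*} (k : Fin p → ℕ) {α γ : Fin p → ℝ}
    (hα : ∀ i, 0 ≤ α i) (hγ : ∀ i, 0 ≤ γ i ∧ γ i ≤ 1) {n : ℕ} (hn : 1 ≤ n) (s : Finset ι)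
    (Q : ι → Config p n → Prop) (h : ∑ j ∈ s, (1 - Pev k α γ n (Q j)) < 1) :
    ∃ E : Config p n, ∀ j ∈ s, Q j E := by
  by_contra! hne
  refine h.not_ge ?_
  simp_rw [one_sub_Pev]
  simp only [Pev]
  rw [Finset.sum_comm, ← sum_weight_validE k α γ n]
  refine Finset.sum_le_sum fun E _ => ?_
  obtain ⟨j, hj, hQ⟩ := hne E
  have hw := weight_nonneg k hα hγ hn E
  calc weight k α γ n E = if ¬ Q j E then weight k α γ n E else 0 := by simp [hQ]
    _ ≤ ∑ i ∈ s, if ¬ Q i E then weight k α γ n E else 0 :=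
      Finset.single_le_sum (f := fun i => if ¬ Q i E then weight k α γ n E else 0)
        (fun i _ => ite_nonneg hw le_rfl) hj
    _ = _ := by congr!

-- STATEMENT 3
theorem Talpha_finite_model_property (k : Fin p → ℕ) (α γ : Fin p → ℝ)
    (hα : ∀ i, 0 < α i ∧ α i ≤ 1) (hγ : ∀ i, 0 < γ i ∧ γ i ≤ 1)
    (hirr : IrrHyp α) (σ : (Lang p k).Sentence) (hσ : Talpha k α γ ⊨ᵇ σ) (n₀ : ℕ) :
    ∃ (M : Type) (S : (Lang p k).Structure M),
      Finite M ∧ n₀ ≤ Nat.card M ∧ RealizeS k M S σ := by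
  obtain ⟨T₀, hT₀, hT₀σ⟩ := Language.Theory.models_iff_finset_models.1 hσ
  have hlim : Tendsto (fun n => ∑ φ ∈ T₀, (1 - Pn k α γ n φ)) atTop (𝓝 0) := by
    simpa using tendsto_finsetSum T₀ fun φ hφ =>
      (tendsto_const_nhds (x := (1 : ℝ))).sub (show Tendsto _ _ _ from hT₀ hφ)
  obtain ⟨n, hlt, hn, hn₀⟩ := ((hlim.eventually (gt_mem_nhds one_pos)).and
    ((eventually_ge_atTop 1).and (eventually_ge_atTop n₀))).exists
  obtain ⟨E, hE⟩ := exists_forall_of_sum_one_sub_Pev_lt_one k (fun i => (hα i).1.le)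
    (fun i => ⟨(hγ i).1.le, (hγ i).2⟩) hn T₀ _ hlt
  refine ⟨Fin n, structOf k n E, inferInstance, by simpa using hn₀, ?_⟩
  let := structOf k n E
  have : Nonempty (Fin n) := ⟨⟨0, hn⟩⟩
  have : Fin n ⊨ (T₀ : (Lang p k).Theory) := ⟨fun φ hφ => hE φ hφ⟩
  exact hT₀σ.realize_sentence (Fin n)
end

section
/- For any finite structures A ⊆ C with C ∈ K_α, there exists B with A ⊆ B ⊆ C such that A ≤_i B and B ≤_s C. -/
open FirstOrder Filter Topology
open scoped Classical

variable {p : ℕ}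

theorem StrongIn.trans {k : Fin p → ℕ} {α : Fin p → ℝ} {M : Type*} [(Lang p k).Structure M]
    {A B C : Finset M} (hAB : StrongIn k α A B) (hBC : StrongIn k α B C) : StrongIn k α A C :=
  ⟨hAB.1.trans hBC.1, fun X hX => (hAB.2 X hX).trans (hBC.2 X (hX.trans hAB.1))⟩

theorem StrongIn.refl (k : Fin p → ℕ) (α : Fin p → ℝ) {M : Type*} [(Lang p k).Structure M]
    (A : Finset M) : StrongIn k α A A :=
  ⟨Finset.Subset.refl A, fun _ _ => rfl⟩

theorem exists_intrinsic_strong (k : Fin p → ℕ) (α : Fin p → ℝ)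
    (hα : ∀ i, 0 < α i ∧ α i ≤ 1) (N : Type*) [(Lang p k).Structure N]
    (hN : SymmIrr k N) (A C : Finset N) (hAC : A ⊆ C)
    (hC : ∀ C' : Finset N, C' ⊆ C → 0 ≤ delta k α C') :
    ∃ B : Finset N, A ⊆ B ∧ B ⊆ C ∧ IntrinsicIn k α A B ∧ StrongIn k α B C := by
  obtain ⟨B, ⟨hAB, hBC⟩, hmin⟩ := wellFounded_lt.has_min
    {B : Finset N | A ⊆ B ∧ StrongIn k α B C} ⟨C, hAC, StrongIn.refl k α C⟩
  exact ⟨B, hAB, hBC.1, ⟨hAB, fun A' hA hlt hs => hmin A' ⟨hA, hs.trans hBC⟩ hlt⟩, hBC⟩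
end
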